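/- arXiv:2204.10642 — 3 statements merged into one kernel-verified Lean document; each statement's English description precedes it below -/
import Mathlib

section
/- Let n ≥ 1, C > 0, and let B be an n×n complex matrix with trace zero and Σ_{i,j} |B_{ij}|² ≤ C. Fix 1 ≤ k ≤ n and let T > 0. Then for a Haar-random unitary matrix u ∈ U(n), P(|Σ_{i,j} conj(u_{ik})·B_{ij}·u_{jk}| ≥ T) ≤ 6·exp(−n·T/(32·√C)) + 2·exp(−n/6). -/
open MeasureTheory

namespace Stmt10

abbrev UG (n : ℕ) := Matrix.unitaryGroup (Fin n) ℂ

lemma sum_sq_col {n : ℕ} (u : UG n) (k : Fin n) : ∑ i, ‖(u : Matrix (Fin n) (Fin n) ℂ) i k‖ ^ 2 = 1 := by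
  have h := Matrix.mem_unitaryGroup_iff'.1 u.2
  have h2 := congrFun (congrFun h k) k
  simp only [Matrix.mul_apply, Matrix.star_apply, Matrix.one_apply_eq] at h2
  have h3 : ((∑ i, ‖(u : Matrix (Fin n) (Fin n) ℂ) i k‖ ^ 2 : ℝ) : ℂ) = 1 := by
    rw [← h2]
    push_cast
    refine Finset.sum_congr rfl fun i _ => ?_
    exact (Complex.conj_mul' _).symm
  exact_mod_cast h3

lemma entry_norm_le {n : ℕ} (u : UG n) (i k : Fin n) : ‖(u : Matrix (Fin n) (Fin n) ℂ) i k‖ ≤ 1 := by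
  have h := sum_sq_col u k
  have h2 : ‖(u : Matrix (Fin n) (Fin n) ℂ) i k‖ ^ 2 ≤ 1 := by
    rw [← h]
    exact Finset.single_le_sum (f := fun i => ‖(u : Matrix (Fin n) (Fin n) ℂ) i k‖ ^ 2)
      (fun _ _ => by positivity) (Finset.mem_univ i)
  exact (sq_le_one_iff₀ (norm_nonneg _)).1 h2

lemma compactUG (n : ℕ) : CompactSpace (UG n) := by
  apply isCompact_iff_compactSpace.1
  have hc : IsClosed (Matrix.unitaryGroup (Fin n) ℂ : Set (Matrix (Fin n) (Fin n) ℂ)) := by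
    have : (Matrix.unitaryGroup (Fin n) ℂ : Set (Matrix (Fin n) (Fin n) ℂ)) =
        {A | A * star A = 1} := by
      ext A
      exact Matrix.mem_unitaryGroup_iff
    rw [this]
    exact isClosed_eq (by fun_prop) continuous_const
  have hk : IsCompact (Set.univ.pi fun _ : Fin n => Set.univ.pi fun _ : Fin n =>
      Metric.closedBall (0 : ℂ) 1) :=
    isCompact_univ_pi fun _ => isCompact_univ_pi fun _ => isCompact_closedBall _ _
  refine IsCompact.of_isClosed_subset hk hc ?_
  intro A hA i _ j _
  simpa using entry_norm_le ⟨A, hA⟩ i j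

lemma rightInv {n : ℕ} [MeasurableSpace (UG n)] [BorelSpace (UG n)] (μ : Measure (UG n))
    [μ.IsMulLeftInvariant] [IsProbabilityMeasure μ] (W : UG n) :
    μ.map (fun u => u * W) = μ := by
  have := compactUG n
  have : μ.IsHaarMeasure := by
    refine Measure.isHaarMeasure_of_isCompact_nonempty_interior μ Set.univ isCompact_univ
      (by simp) (by simp) (by simp)
  have hm : Measurable (fun u : UG n => u * W) := (continuous_mul_const W).measurable
  have : IsProbabilityMeasure (μ.map (fun u => u * W)) := Measure.isProbabilityMeasure_map hm.aemeasurable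
  have : (μ.map (fun u => u * W)).IsMulLeftInvariant := by
    refine ⟨fun g => ?_⟩
    have hg : Measurable (fun u : UG n => g * u) := (continuous_const_mul g).measurable
    rw [Measure.map_map hg hm]
    conv_rhs => rw [← map_mul_left_eq_self μ g]
    rw [Measure.map_map hm hg]
    congr 1
    ext u : 1
    simp [mul_assoc]
  have h := Measure.isMulInvariant_eq_smul_of_compactSpace (μ.map (fun u => u * W)) μ
  have h1 := congrArg (fun m => m Set.univ) h
  have h2 : ((μ.map (fun u => u * W)).haarScalarFactor μ) = 1 := by
    generalize (μ.map (fun u => u * W)).haarScalarFactor μ = c at h1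
    rw [measure_univ, Measure.smul_apply, measure_univ, ENNReal.smul_def, smul_eq_mul, mul_one] at h1
    exact_mod_cast h1.symm
  rw [h2, one_smul] at h
  exact h

/-- Transitivity on spheres. -/
lemma exists_unitary {n : ℕ} (k : Fin n) (z : Fin n → ℂ) :
    ∃ W : UG n, ∀ i, z i = (Real.sqrt (∑ j, ‖z j‖ ^ 2) : ℂ) * (W : Matrix (Fin n) (Fin n) ℂ) i k := by
  set r := Real.sqrt (∑ j, ‖z j‖ ^ 2) with hr
  by_cases h0 : r = 0
  · refine ⟨1, fun i => ?_⟩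
    have hs : ∑ j, ‖z j‖ ^ 2 = 0 := by
      rwa [hr, Real.sqrt_eq_zero (by positivity)] at h0
    rw [Finset.sum_eq_zero_iff_of_nonneg (by intros; positivity)] at hs
    have := hs i (Finset.mem_univ i)
    simp [h0]
    simpa using this
  · let v : Fin n → EuclideanSpace ℂ (Fin n) := fun _ => WithLp.toLp 2 (fun i => z i / (r : ℂ))
    have hv : ‖v k‖ = 1 := by
      rw [EuclideanSpace.norm_eq]
      simp only [v, norm_div, div_pow]
      rw [← Finset.sum_div]
      have : ∑ j, ‖z j‖ ^ 2 = r ^ 2 := by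
        rw [hr, Real.sq_sqrt (by positivity)]
      rw [this]
      simp [h0]
    have ho : Orthonormal ℂ (({k} : Set (Fin n)).domRestrict v) := by
      rw [orthonormal_iff_ite]
      rintro ⟨i, hi⟩ ⟨j, hj⟩
      obtain rfl : i = k := hi
      obtain rfl : j = i := hj
      simp [hv]
    obtain ⟨b, hb⟩ := ho.exists_orthonormalBasis_extension_of_card_eq (by simp)
    refine ⟨⟨_, (EuclideanSpace.basisFun (Fin n) ℂ).toMatrix_orthonormalBasis_mem_unitary b⟩,
      fun i => ?_⟩
    have hbk := hb k rfl
    have hrc : (r : ℂ) ≠ 0 := by exact_mod_cast h0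
    simp [Module.Basis.toMatrix_apply, hbk, v]
    field_simp

lemma gauss1 {b : ℝ} (hb : 0 < b) : ∫ z : ℂ, Real.exp (-b * ‖z‖ ^ 2) = Real.pi / b := by
  have h := Complex.integral_rpow_mul_exp_neg_mul_rpow (p := 2) (q := 0) (b := b) (by norm_num)
    (by norm_num) hb
  simp [Real.rpow_neg_one] at h
  simp [h, div_eq_mul_inv]

lemma gaussN {n : ℕ} (b : Fin n → ℝ) (hb : ∀ i, 0 < b i) :
    ∫⁻ z : Fin n → ℂ, ENNReal.ofReal (Real.exp (-∑ i, b i * ‖z i‖ ^ 2)) =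
      ENNReal.ofReal (∏ i, (Real.pi / b i)) := by
  have h : ∫ z : Fin n → ℂ, Real.exp (-∑ i, b i * ‖z i‖ ^ 2) = ∏ i, (Real.pi / b i) := by
    have := integral_fintype_prod_volume_eq_prod (fun i (z : ℂ) => Real.exp (-b i * ‖z‖ ^ 2))
    simp only [← Real.exp_sum] at this
    simp only [gauss1 (hb _)] at this
    rw [← this]
    simp [Finset.sum_neg_distrib]
  rw [← h, ofReal_integral_eq_lintegral_ofReal]
  · refine not_imp_comm.1 integral_undef ?_
    rw [h]
    exact (Finset.prod_pos fun i _ => div_pos Real.pi_pos (hb i)).ne'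
  · exact Filter.Eventually.of_forall fun z => (Real.exp_pos _).le

lemma vol_inv {n : ℕ} (u : UG n) :
    MeasurePreserving (fun z : Fin n → ℂ => (u : Matrix (Fin n) (Fin n) ℂ).mulVec z) := by
  refine ⟨by fun_prop, ?_⟩
  let f : (Fin n → ℂ) →ₗ[ℂ] (Fin n → ℂ) := Matrix.toLin' (u : Matrix (Fin n) (Fin n) ℂ)
  have hd : LinearMap.det (f.restrictScalars ℝ) = 1 := by
    rw [LinearMap.det_restrictScalars, Algebra.norm_complex_eq]
    have := Matrix.det_of_mem_unitary u.2
    rw [LinearMap.det_toLin']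
    have h2 := (Unitary.mem_iff.1 this).1
    have h3 : ((Complex.normSq (u : Matrix (Fin n) (Fin n) ℂ).det : ℝ) : ℂ) = 1 := by
      rw [Complex.normSq_eq_conj_mul_self]; exact h2
    exact_mod_cast h3
  have := Measure.map_linearMap_addHaar_eq_smul_addHaar (volume : Measure (Fin n → ℂ))
    (f := f.restrictScalars ℝ) (by rw [hd]; exact one_ne_zero)
  rw [hd] at this
  simpa [f] using! this

lemma contEntry {n : ℕ} (i j : Fin n) :
    Continuous fun u : UG n => (u : Matrix (Fin n) (Fin n) ℂ) i j :=
  continuous_subtype_val.matrix_elem i j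

lemma contY {n : ℕ} (a : Fin n → ℝ) (k : Fin n) :
    Continuous fun u : UG n => ∑ i, a i * ‖(u : Matrix (Fin n) (Fin n) ℂ) i k‖ ^ 2 :=
  continuous_finsetSum _ fun i _ => continuous_const.mul ((contEntry i k).norm.pow 2)

lemma contF {n : ℕ} (a : Fin n → ℝ) :
    Continuous fun x : UG n × (Fin n → ℂ) =>
      Real.exp (-∑ i, (1 - a i) * ‖(x.1 : Matrix (Fin n) (Fin n) ℂ).mulVec x.2 i‖ ^ 2) := by
  refine Real.continuous_exp.comp (continuous_finsetSum _ fun i _ =>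
    continuous_const.mul (Continuous.pow (Continuous.norm ?_) 2)).neg
  simp only [Matrix.mulVec, dotProduct]
  exact continuous_finsetSum _ fun j _ => ((contEntry i j).comp continuous_fst).mul
    ((continuous_apply j).comp continuous_snd)

lemma one_div_le_exp {x : ℝ} (hx : x ≤ 1 / 2) : 1 / (1 - x) ≤ Real.exp (x + 2 * x ^ 2) := by
  rw [div_le_iff₀ (by linarith)]
  have h := Real.add_one_le_exp (x + 2 * x ^ 2)
  have : 1 ≤ (x + 2 * x ^ 2 + 1) * (1 - x) := by nlinarith [sq_nonneg x]
  nlinarith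

set_option maxHeartbeats 1000000 in
lemma core {n : ℕ} [MeasurableSpace (UG n)] [BorelSpace (UG n)] (μ : Measure (UG n))
    [μ.IsMulLeftInvariant] [IsProbabilityMeasure μ] (k : Fin n) (a : Fin n → ℝ)
    (ha : ∑ i, a i = 0) (ha2 : ∑ i, a i ^ 2 ≤ 1 / 16) :
    ∫⁻ u, ENNReal.ofReal (Real.exp (n * ∑ i, a i * ‖(u : Matrix (Fin n) (Fin n) ℂ) i k‖ ^ 2)) ∂μ ≤
      ENNReal.ofReal (Real.exp (1 / 8)) := by
  have hle : ∀ i, a i ≤ 1 / 4 := by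
    intro i
    have : a i ^ 2 ≤ ∑ i, a i ^ 2 := Finset.single_le_sum (f := fun i => a i ^ 2)
      (fun _ _ => by positivity) (Finset.mem_univ i)
    nlinarith
  set Y : UG n → ℝ := fun u => ∑ i, a i * ‖(u : Matrix (Fin n) (Fin n) ℂ) i k‖ ^ 2 with hY
  have hYle : ∀ u, Y u ≤ 1 / 4 := by
    intro u
    calc Y u ≤ ∑ i, (1 / 4) * ‖(u : Matrix (Fin n) (Fin n) ℂ) i k‖ ^ 2 :=
          Finset.sum_le_sum fun i _ => mul_le_mul_of_nonneg_right (hle i) (by positivity)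
      _ = 1 / 4 := by rw [← Finset.mul_sum, sum_sq_col, mul_one]
  let F : UG n → (Fin n → ℂ) → ENNReal := fun u z => ENNReal.ofReal
    (Real.exp (-∑ i, (1 - a i) * ‖(u : Matrix (Fin n) (Fin n) ℂ).mulVec z i‖ ^ 2))
  let G : UG n → (Fin n → ℂ) → ENNReal := fun u z => ENNReal.ofReal
    (Real.exp (-∑ i, (1 - Y u) * ‖z i‖ ^ 2))
  have hFm : Measurable (Function.uncurry F) := by
    exact ENNReal.measurable_ofReal.comp (contF a).measurable
  have hYc : Continuous Y := contY a k
  have hGm : Measurable (Function.uncurry G) := by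
    refine ENNReal.measurable_ofReal.comp (Continuous.measurable ?_)
    refine Real.continuous_exp.comp (continuous_finsetSum _ fun i _ => ?_).neg
    exact (continuous_const.sub (hYc.comp continuous_fst)).mul
      (((continuous_apply i).comp continuous_snd).norm.pow 2)
  have hA : ∀ u, ∫⁻ z, F u z = ENNReal.ofReal (∏ i, (Real.pi / (1 - a i))) := by
    intro u
    rw [← gaussN (fun i => 1 - a i) (fun i => by linarith [hle i])]
    exact (vol_inv u).lintegral_comp (f := fun z : Fin n → ℂ => ENNReal.ofReal
      (Real.exp (-∑ i, (1 - a i) * ‖z i‖ ^ 2))) (by fun_prop)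
  have hB : ∀ z, ∫⁻ u, F u z ∂μ = ∫⁻ u, G u z ∂μ := by
    intro z
    obtain ⟨W, hW⟩ := exists_unitary k z
    have hGm' : Measurable fun u => G u z := hGm.of_uncurry_right
    have hm : Measurable (fun u : UG n => u * W) := (continuous_mul_const W).measurable
    conv_rhs => rw [← rightInv μ W]
    rw [lintegral_map hGm' hm]
    refine lintegral_congr fun u => ?_
    simp only [F, G]
    congr 3
    rw [← Finset.mul_sum]
    set R := ∑ j, ‖z j‖ ^ 2 with hR
    have hR0 : 0 ≤ R := by positivity
    have h1 : ∀ i, ‖(u : Matrix (Fin n) (Fin n) ℂ).mulVec z i‖ ^ 2 =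
        R * ‖((u * W : UG n) : Matrix (Fin n) (Fin n) ℂ) i k‖ ^ 2 := by
      intro i
      have : (u : Matrix (Fin n) (Fin n) ℂ).mulVec z i =
          (Real.sqrt R : ℂ) * ((u * W : UG n) : Matrix (Fin n) (Fin n) ℂ) i k := by
        simp only [Matrix.mulVec, dotProduct, Submonoid.coe_mul, Matrix.mul_apply, Finset.mul_sum]
        refine Finset.sum_congr rfl fun j _ => ?_
        rw [hW j]; ring
      rw [this, norm_mul, mul_pow, Complex.norm_real, Real.norm_eq_abs, sq_abs, Real.sq_sqrt hR0]
    simp only [h1, hY]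
    have h2 := sum_sq_col (u * W) k
    calc _ = R * (∑ i, ‖((u * W : UG n) : Matrix (Fin n) (Fin n) ℂ) i k‖ ^ 2 -
          ∑ i, a i * ‖((u * W : UG n) : Matrix (Fin n) (Fin n) ℂ) i k‖ ^ 2) := by
            rw [← Finset.sum_sub_distrib, Finset.mul_sum]
            exact Finset.sum_congr rfl fun i _ => by ring
      _ = _ := by rw [h2]; ring
  have hC : ∀ u, ENNReal.ofReal (Real.pi ^ n) * ENNReal.ofReal (Real.exp (n * Y u)) ≤
      ∫⁻ z, G u z := by
    intro u
    have hp : 0 < 1 - Y u := by linarith [hYle u]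
    simp only [G]
    rw [gaussN (fun _ => 1 - Y u) (fun _ => hp), ← ENNReal.ofReal_mul (by positivity)]
    refine ENNReal.ofReal_le_ofReal ?_
    simp only [Finset.prod_const, Finset.card_univ, Fintype.card_fin]
    rw [Real.exp_nat_mul, ← mul_pow]
    refine pow_le_pow_left₀ (by positivity) ?_ n
    rw [le_div_iff₀ hp, mul_assoc]
    refine mul_le_of_le_one_right Real.pi_pos.le ?_
    have h := Real.add_one_le_exp (-Y u)
    calc Real.exp (Y u) * (1 - Y u) ≤ Real.exp (Y u) * Real.exp (-Y u) := by
          gcongr; linarith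
      _ = 1 := by rw [← Real.exp_add]; simp
  have hD : ∏ i, (Real.pi / (1 - a i)) ≤ Real.pi ^ n * Real.exp (1 / 8) := by
    calc ∏ i, (Real.pi / (1 - a i)) ≤ ∏ i, (Real.pi * Real.exp (a i + 2 * a i ^ 2)) := by
          refine Finset.prod_le_prod (fun i _ => ?_) fun i _ => ?_
          · have := hle i
            exact div_nonneg Real.pi_pos.le (by linarith)
          · rw [div_eq_mul_one_div]
            exact mul_le_mul_of_nonneg_left (one_div_le_exp (by linarith [hle i])) Real.pi_pos.le
      _ = Real.pi ^ n * Real.exp (∑ i, a i + 2 * ∑ i, a i ^ 2) := by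
          rw [Finset.prod_mul_distrib, ← Real.exp_sum, Finset.sum_add_distrib, Finset.mul_sum]
          simp
      _ ≤ _ := by
          gcongr
          rw [ha]; linarith
  have hpi0 : ENNReal.ofReal (Real.pi ^ n) ≠ 0 := by
    simp [Real.pi_pos]
  refine (ENNReal.mul_le_mul_iff_right hpi0 ENNReal.ofReal_ne_top).1 ?_
  rw [← lintegral_const_mul' _ _ ENNReal.ofReal_ne_top, ← ENNReal.ofReal_mul (by positivity)]
  calc _ ≤ ∫⁻ u, (∫⁻ z, G u z) ∂μ := lintegral_mono hC
    _ = ∫⁻ z, ∫⁻ u, G u z ∂μ := lintegral_lintegral_swap hGm.aemeasurable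
    _ = ∫⁻ z, ∫⁻ u, F u z ∂μ := by simp only [hB]
    _ = ∫⁻ u, (∫⁻ z, F u z) ∂μ := (lintegral_lintegral_swap hFm.aemeasurable).symm
    _ = ENNReal.ofReal (∏ i, (Real.pi / (1 - a i))) := by
        simp only [hA, lintegral_const, measure_univ, mul_one]
    _ ≤ _ := ENNReal.ofReal_le_ofReal hD

lemma herm {n : ℕ} [MeasurableSpace (UG n)] [BorelSpace (UG n)] (μ : Measure (UG n))
    [μ.IsMulLeftInvariant] [IsProbabilityMeasure μ] (k : Fin n) (C : ℝ) (hC : 0 < C)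
    (H : Matrix (Fin n) (Fin n) ℂ) (hH : H.IsHermitian) (htr : H.trace = 0)
    (hHS : ∑ i, ∑ j, ‖H i j‖ ^ 2 ≤ C) (T : ℝ) :
    μ {u : UG n | T ≤ ((star (u : Matrix (Fin n) (Fin n) ℂ) * H * u) k k).re} ≤
      ENNReal.ofReal (Real.exp (1 / 8) * Real.exp (-(n * T / (4 * Real.sqrt C)))) := by
  set l := hH.eigenvalues with hl
  set V := hH.eigenvectorUnitary with hV
  have hsp : H = (V : Matrix (Fin n) (Fin n) ℂ) * Matrix.diagonal (fun i => (l i : ℂ)) *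
      star (V : Matrix (Fin n) (Fin n) ℂ) := by
    have := hH.spectral_theorem
    rw [Unitary.conjStarAlgAut_apply] at this
    exact this
  have hVV : star (V : Matrix (Fin n) (Fin n) ℂ) * V = 1 := Matrix.mem_unitaryGroup_iff'.1 V.2
  have hl1 : ∑ i, l i = 0 := by
    have := hH.trace_eq_sum_eigenvalues
    rw [htr] at this
    have h2 : ((∑ i, l i : ℝ) : ℂ) = 0 := by push_cast; exact this.symm
    exact_mod_cast h2
  have hl2 : ∑ i, l i ^ 2 ≤ C := by
    refine le_trans (le_of_eq ?_) hHS
    have h1 : (H * H).trace = ((∑ i, l i ^ 2 : ℝ) : ℂ) := by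
      have : H * H = (V : Matrix (Fin n) (Fin n) ℂ) * (Matrix.diagonal (fun i => (l i : ℂ)) *
          Matrix.diagonal (fun i => (l i : ℂ))) * star (V : Matrix (Fin n) (Fin n) ℂ) := by
        conv_lhs => rw [hsp]
        simp only [mul_assoc]
        rw [← mul_assoc (star (V : Matrix (Fin n) (Fin n) ℂ)) (V : Matrix (Fin n) (Fin n) ℂ), hVV,
          one_mul]
      rw [this, Matrix.trace_mul_cycle, hVV, one_mul, Matrix.diagonal_mul_diagonal,
        Matrix.trace_diagonal]
      push_cast
      exact Finset.sum_congr rfl fun i _ => by ring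
    have h2 : (H * H).trace = ((∑ i, ∑ j, ‖H i j‖ ^ 2 : ℝ) : ℂ) := by
      simp only [Matrix.trace, Matrix.diag, Matrix.mul_apply]
      push_cast
      refine Finset.sum_congr rfl fun i _ => Finset.sum_congr rfl fun j _ => ?_
      rw [← hH.apply j i]
      exact Complex.mul_conj' _
    exact_mod_cast h1.symm.trans h2
  have hq : ∀ u : UG n, ((star (u : Matrix (Fin n) (Fin n) ℂ) * H * u) k k).re =
      ∑ i, l i * ‖((star V * u : UG n) : Matrix (Fin n) (Fin n) ℂ) i k‖ ^ 2 := by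
    intro u
    have h1 : star (u : Matrix (Fin n) (Fin n) ℂ) * H * u =
        star ((star V * u : UG n) : Matrix (Fin n) (Fin n) ℂ) *
          (Matrix.diagonal (fun i => (l i : ℂ)) *
          ((star V * u : UG n) : Matrix (Fin n) (Fin n) ℂ)) := by
      rw [Submonoid.coe_mul, Unitary.coe_star, star_mul, star_star]
      conv_lhs => rw [hsp]
      simp only [mul_assoc]
    have h2 : (star (u : Matrix (Fin n) (Fin n) ℂ) * H * u) k k =
        ((∑ i, l i * ‖((star V * u : UG n) : Matrix (Fin n) (Fin n) ℂ) i k‖ ^ 2 : ℝ) : ℂ) := by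
      rw [h1, Matrix.mul_apply]
      push_cast
      refine Finset.sum_congr rfl fun i _ => ?_
      rw [Matrix.diagonal_mul, Matrix.star_apply, ← Complex.conj_mul']
      simp only [starRingEnd_apply]
      ring
    rw [h2, Complex.ofReal_re]
  have hs : 0 < Real.sqrt C := Real.sqrt_pos.2 hC
  set θ := 1 / (4 * Real.sqrt C) with hθ
  have hθ0 : 0 < θ := by positivity
  have hθ2 : θ ^ 2 * C = 1 / 16 := by
    rw [hθ, div_pow, mul_pow, Real.sq_sqrt hC.le]
    field_simp
    norm_num
  have hcore := core μ k (fun i => θ * l i) (by rw [← Finset.mul_sum, hl1, mul_zero]) (by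
    simp only [mul_pow]
    rw [← Finset.mul_sum, ← hθ2]
    exact mul_le_mul_of_nonneg_left hl2 (by positivity))
  set f : UG n → ENNReal := fun u => ENNReal.ofReal
    (Real.exp (n * ∑ i, θ * l i * ‖(u : Matrix (Fin n) (Fin n) ℂ) i k‖ ^ 2)) with hf
  have hfm : Measurable f := by
    exact ENNReal.measurable_ofReal.comp
      (Real.continuous_exp.comp (continuous_const.mul (contY (fun i => θ * l i) k))).measurable
  have hgm : Measurable (fun u : UG n => star V * u) := (continuous_const_mul _).measurable
  have hint : ∫⁻ u, f (star V * u) ∂μ ≤ ENNReal.ofReal (Real.exp (1 / 8)) := by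
    rw [lintegral_mul_left_eq_self f (star V)]
    exact hcore
  have hmk := mul_meas_ge_le_lintegral (μ := μ) (hfm.comp hgm)
    (ENNReal.ofReal (Real.exp (n * (θ * T))))
  have hsub : {u : UG n | T ≤ ((star (u : Matrix (Fin n) (Fin n) ℂ) * H * u) k k).re} ⊆
      {u | ENNReal.ofReal (Real.exp (n * (θ * T))) ≤ (f ∘ fun u : UG n => star V * u) u} := by
    intro u hu
    simp only [Set.mem_ofPred_eq, hq] at hu
    refine ENNReal.ofReal_le_ofReal (Real.exp_le_exp.2 ?_)
    simp only [mul_assoc]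
    rw [← Finset.mul_sum]
    gcongr
  have h3 := (mul_le_mul_right (measure_mono (μ := μ) hsub)
    (ENNReal.ofReal (Real.exp (n * (θ * T))))).trans (hmk.trans hint)
  have h4 : ENNReal.ofReal (Real.exp (n * (θ * T))) ≠ 0 := by simp [Real.exp_pos]
  refine (ENNReal.mul_le_mul_iff_right h4 ENNReal.ofReal_ne_top).1 (h3.trans ?_)
  rw [← ENNReal.ofReal_mul (Real.exp_pos _).le, ← Real.exp_add, ← Real.exp_add]
  refine ENNReal.ofReal_le_ofReal (Real.exp_le_exp.2 (le_of_eq ?_))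
  rw [hθ]
  field_simp
  ring

lemma phase {n : ℕ} [MeasurableSpace (UG n)] [BorelSpace (UG n)] (μ : Measure (UG n))
    [μ.IsMulLeftInvariant] [IsProbabilityMeasure μ] (k : Fin n) (C : ℝ) (hC : 0 < C)
    (B : Matrix (Fin n) (Fin n) ℂ) (htr : B.trace = 0)
    (hHS : ∑ i, ∑ j, ‖B i j‖ ^ 2 ≤ C) (T : ℝ) (c : ℂ) (hc : ‖c‖ = 1) :
    μ {u : UG n | T ≤ (c * (star (u : Matrix (Fin n) (Fin n) ℂ) * B * u) k k).re} ≤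
      ENNReal.ofReal (Real.exp (1 / 8) * Real.exp (-(n * T / (4 * Real.sqrt C)))) := by
  set H : Matrix (Fin n) (Fin n) ℂ := (1 / 2 : ℂ) • (c • B + star (c • B)) with hH
  have hherm : H.IsHermitian := by
    rw [Matrix.IsHermitian, ← Matrix.star_eq_conjTranspose, hH, star_smul, star_add, star_star,
      add_comm]
    congr 1
    simp
  have htrH : H.trace = 0 := by
    rw [hH, Matrix.trace_smul, Matrix.trace_add, Matrix.star_eq_conjTranspose,
      Matrix.trace_conjTranspose, Matrix.trace_smul, htr]
    simp
  have hHSH : ∑ i, ∑ j, ‖H i j‖ ^ 2 ≤ C := by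
    have h1 : ∀ i j, ‖H i j‖ ^ 2 ≤ (1 / 2) * ‖B i j‖ ^ 2 + (1 / 2) * ‖B j i‖ ^ 2 := by
      intro i j
      have h2 : ‖H i j‖ ≤ (1 / 2) * (‖B i j‖ + ‖B j i‖) := by
        have : H i j = (1 / 2) * (c * B i j + star (c * B j i)) := rfl
        rw [this, norm_mul]
        have h3 := norm_add_le (c * B i j) (star (c * B j i))
        rw [norm_star, norm_mul, norm_mul, hc, one_mul, one_mul] at h3
        have h4 : ‖(1 / 2 : ℂ)‖ = 1 / 2 := by simp
        rw [h4]
        gcongr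
      have h5 := pow_le_pow_left₀ (norm_nonneg _) h2 2
      nlinarith [sq_nonneg (‖B i j‖ - ‖B j i‖)]
    calc _ ≤ ∑ i, ∑ j, ((1 / 2) * ‖B i j‖ ^ 2 + (1 / 2) * ‖B j i‖ ^ 2) :=
          Finset.sum_le_sum fun i _ => Finset.sum_le_sum fun j _ => h1 i j
      _ = ∑ i, ∑ j, ‖B i j‖ ^ 2 := by
          simp only [Finset.sum_add_distrib, ← Finset.mul_sum]
          rw [Finset.sum_comm (f := fun i j => ‖B j i‖ ^ 2)]
          ring
      _ ≤ C := hHS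
  refine le_trans (le_of_eq ?_) (herm μ k C hC H hherm htrH hHSH T)
  congr 1
  ext u
  simp only [Set.mem_ofPred_eq]
  have : (c * (star (u : Matrix (Fin n) (Fin n) ℂ) * B * u) k k).re =
      ((star (u : Matrix (Fin n) (Fin n) ℂ) * H * u) k k).re := by
    set A := star (u : Matrix (Fin n) (Fin n) ℂ) * B * u with hA
    have : star (u : Matrix (Fin n) (Fin n) ℂ) * H * u = (1 / 2 : ℂ) • (c • A + star (c • A)) := by
      rw [hH, hA]
      simp only [star_smul, star_mul, star_star, Matrix.mul_smul, Matrix.smul_mul, mul_add, add_mul,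
        mul_assoc]
    rw [this]
    change _ = ((1 / 2 : ℂ) * (c * A k k + star (c * A k k))).re
    have h6 := Complex.add_conj (c * A k k)
    rw [starRingEnd_apply] at h6
    rw [h6]
    simp
  rw [this]

end Stmt10

/-- Concentration for diagonal matrix coefficients `⟨u eₖ, B u eₖ⟩` of a trace-zero matrix `B`
under a Haar-random unitary `u ∈ U(n)`. -/
theorem stmt_10 (n : ℕ) (hn : 1 ≤ n)
    (C : ℝ) (hC : 0 < C)
    (B : Matrix (Fin n) (Fin n) ℂ)
    (htr : B.trace = 0)
    (hHS : ∑ i, ∑ j, ‖B i j‖ ^ 2 ≤ C)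
    (k : Fin n) (T : ℝ) (hT : 0 < T)
    [MeasurableSpace (Matrix.unitaryGroup (Fin n) ℂ)]
    [BorelSpace (Matrix.unitaryGroup (Fin n) ℂ)]
    (μ : Measure (Matrix.unitaryGroup (Fin n) ℂ))
    [μ.IsMulLeftInvariant] [IsProbabilityMeasure μ] :
    μ {u : Matrix.unitaryGroup (Fin n) ℂ |
        T ≤ ‖∑ i, ∑ j, (starRingEnd ℂ) (u i k) * B i j * u j k‖} ≤
      ENNReal.ofReal (6 * Real.exp (-(n * T / (32 * Real.sqrt C))) +
        2 * Real.exp (-(n : ℝ) / 6)) := by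
  let S : ℂ → Set (Matrix.unitaryGroup (Fin n) ℂ) := fun c =>
    {u | T / 2 ≤ (c * (star (u : Matrix (Fin n) (Fin n) ℂ) * B * u) k k).re}
  have hS : ∀ c : ℂ, ‖c‖ = 1 → μ (S c) ≤ ENNReal.ofReal
      (Real.exp (1 / 8) * Real.exp (-(n * (T / 2) / (4 * Real.sqrt C)))) := fun c hc =>
    Stmt10.phase μ k C hC B htr hHS (T / 2) c hc
  set q := Real.exp (1 / 8) * Real.exp (-(n * (T / 2) / (4 * Real.sqrt C))) with hq
  have hq0 : 0 ≤ q := by positivity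
  have hsub : {u : Matrix.unitaryGroup (Fin n) ℂ |
        T ≤ ‖∑ i, ∑ j, (starRingEnd ℂ) (u i k) * B i j * u j k‖} ⊆
      (S 1 ∪ S (-1)) ∪ (S Complex.I ∪ S (-Complex.I)) := by
    intro u hu
    have hX : ∑ i, ∑ j, (starRingEnd ℂ) (u i k) * B i j * u j k =
        (star (u : Matrix (Fin n) (Fin n) ℂ) * B * u) k k := by
      simp only [Matrix.mul_apply, Finset.sum_mul, Matrix.star_apply]
      rw [Finset.sum_comm]
      rfl
    simp only [Set.mem_ofPred_eq] at hu
    rw [hX] at hu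
    simp only [S, Set.mem_union, Set.mem_ofPred_eq]
    generalize (star (u : Matrix (Fin n) (Fin n) ℂ) * B * u) k k = x at hu ⊢
    have h := Complex.norm_le_abs_re_add_abs_im x
    by_contra hcon
    push Not at hcon
    obtain ⟨⟨h1, h2⟩, h3, h4⟩ := hcon
    simp at h1 h2 h3 h4
    have h5 : |x.re| < T / 2 := abs_lt.2 ⟨by linarith, h1⟩
    have h6 : |x.im| < T / 2 := abs_lt.2 ⟨by linarith, h4⟩
    linarith
  calc _ ≤ μ ((S 1 ∪ S (-1)) ∪ (S Complex.I ∪ S (-Complex.I))) := measure_mono hsub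
    _ ≤ (μ (S 1) + μ (S (-1))) + (μ (S Complex.I) + μ (S (-Complex.I))) :=
        (measure_union_le _ _).trans (add_le_add (measure_union_le _ _) (measure_union_le _ _))
    _ ≤ (ENNReal.ofReal q + ENNReal.ofReal q) + (ENNReal.ofReal q + ENNReal.ofReal q) := by
        gcongr <;> exact hS _ (by simp)
    _ = ENNReal.ofReal (4 * q) := by
        rw [← ENNReal.ofReal_add hq0 hq0, ← ENNReal.ofReal_add (by positivity) (by positivity)]
        congr 1; ring
    _ ≤ _ := by
        refine ENNReal.ofReal_le_ofReal ?_
        have h1 : Real.exp (1 / 8) ≤ 3 / 2 := by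
          have := Stmt10.one_div_le_exp (x := -(1/8)) (by norm_num)
          have h2 := Real.add_one_le_exp (-(1/8) : ℝ)
          have h3 : Real.exp (1/8) * Real.exp (-(1/8)) = 1 := by rw [← Real.exp_add]; simp
          nlinarith [Real.exp_pos (1/8)]
        have h2 : Real.exp (-(n * (T / 2) / (4 * Real.sqrt C))) ≤
            Real.exp (-(n * T / (32 * Real.sqrt C))) := by
          refine Real.exp_le_exp.2 (neg_le_neg ?_)
          have hs : 0 < Real.sqrt C := Real.sqrt_pos.2 hC
          rw [div_le_div_iff₀ (by positivity) (by positivity)]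
          have : 0 ≤ n * T * Real.sqrt C := by positivity
          nlinarith
        have h3 : q ≤ 3 / 2 * Real.exp (-(n * T / (32 * Real.sqrt C))) :=
          mul_le_mul h1 h2 (Real.exp_pos _).le (by norm_num)
        have := Real.exp_pos (-(n : ℝ) / 6)
        linarith
end

section
/- Let n ≥ 1, C > 0, and let α be an n×n complex matrix with Σ_{i,j} |α_{ij}|² ≤ C. Fix 1 ≤ k ≤ n and let T > 0. Then for a Haar-random unitary matrix u ∈ U(n), P(|Re(Σ_{i,j} α_{ij}·conj(u_{ik})·conj(u_{jk}))| ≥ T) ≤ 6·exp(−n·T/(32·√C)) + 2·exp(−n/6). -/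
open MeasureTheory

namespace HaarCol

/-- The `k`-th column of a unitary matrix. -/
def col {n : ℕ} (k : Fin n) (u : Matrix.unitaryGroup (Fin n) ℂ) : Fin n → ℂ :=
  fun i => (u : Matrix (Fin n) (Fin n) ℂ) i k

lemma continuous_col {n : ℕ} (k : Fin n) : Continuous (col k) := by
  unfold col
  refine continuous_pi fun i => ?_
  exact (continuous_apply k).comp ((continuous_apply i).comp continuous_subtype_val)

lemma col_mem {n : ℕ} (k : Fin n) (u : Matrix.unitaryGroup (Fin n) ℂ) :
    col k u ∈ Metric.closedBall (0 : Fin n → ℂ) 1 := by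
  rw [mem_closedBall_zero_iff, pi_norm_le_iff_of_nonneg zero_le_one]
  intro i
  exact entry_norm_bound_of_unitary u.2 i k

lemma col_mul {n : ℕ} (k : Fin n) (w u : Matrix.unitaryGroup (Fin n) ℂ) :
    col k (w * u) = (w : Matrix (Fin n) (Fin n) ℂ).mulVec (col k u) := by
  ext i
  simp [col, Matrix.mul_apply, Matrix.mulVec, dotProduct]

lemma sum_col {n : ℕ} (k : Fin n) (u : Matrix.unitaryGroup (Fin n) ℂ) :
    ∑ i, (col k u i) * (starRingEnd ℂ) (col k u i) = 1 := by
  have h := congrFun (congrFun (Matrix.mem_unitaryGroup_iff'.1 u.2) k) k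
  simp only [Matrix.mul_apply, Matrix.star_apply, Matrix.one_apply_eq] at h
  rw [← h]
  refine Finset.sum_congr rfl fun i _ => ?_
  simp [col, mul_comm]

lemma exists_bound {n : ℕ} (k : Fin n) {g : (Fin n → ℂ) → ℂ} (hg : Continuous g) :
    ∃ B : ℝ, ∀ u, ‖g (col k u)‖ ≤ B := by
  obtain ⟨B, hB⟩ := (isCompact_closedBall (0 : Fin n → ℂ) 1).exists_bound_of_continuousOn
    hg.continuousOn
  exact ⟨B, fun u => hB _ (col_mem k u)⟩

section
open scoped Matrix.Norms.L2Operator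

lemma exp_curve {n : ℕ} (X : Matrix (Fin n) (Fin n) ℂ) (hX : X.conjTranspose = -X) :
    ∃ W : ℝ → Matrix.unitaryGroup (Fin n) ℂ, W 0 = 1 ∧ ∀ (v : Fin n → ℂ) (t : ℝ),
      HasDerivAt (fun t => (W t : Matrix (Fin n) (Fin n) ℂ).mulVec v)
        (X.mulVec ((W t : Matrix (Fin n) (Fin n) ℂ).mulVec v)) t := by
  have hsk : ∀ t : ℝ, t • X ∈ skewAdjoint (Matrix (Fin n) (Fin n) ℂ) := by
    intro t
    rw [skewAdjoint.mem_iff, star_smul, Matrix.star_eq_conjTranspose, hX]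
    simp
  let _ : NormedAlgebra ℚ (Matrix (Fin n) (Fin n) ℂ) := NormedAlgebra.restrictScalars ℚ ℂ _
  refine ⟨fun t => ⟨NormedSpace.exp (t • X), NormedSpace.exp_mem_unitary_of_mem_skewAdjoint (hsk t)⟩,
    ?_, ?_⟩
  · ext1
    simp
  · intro v t
    have h := hasDerivAt_exp_smul_const' (𝕂 := ℝ) X t
    let L : Matrix (Fin n) (Fin n) ℂ →L[ℝ] (Fin n → ℂ) :=
      LinearMap.toContinuousLinearMap
        { toFun := fun M => M.mulVec v
          map_add' := fun A B => Matrix.add_mulVec A B v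
          map_smul' := fun c A => Matrix.smul_mulVec c A v }
    have h2 := L.hasFDerivAt.comp_hasDerivAt t h
    have e : L (X * NormedSpace.exp (t • X)) = X.mulVec ((NormedSpace.exp (t • X)).mulVec v) := by
      rw [Matrix.mulVec_mulVec]; rfl
    rw [e] at h2
    exact h2
end

lemma fderiv_mul_conj {n : ℕ} {p q : (Fin n → ℂ) → ℂ} (hp : ContDiff ℂ 1 p) (hq : ContDiff ℂ 1 q)
    (v w : Fin n → ℂ) :
    fderiv ℝ (fun v => p v * (starRingEnd ℂ) (q v)) v w =
      fderiv ℂ p v w * (starRingEnd ℂ) (q v) + p v * (starRingEnd ℂ) (fderiv ℂ q v w) := by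
  have h1 := (hp.differentiable (by simp) v).hasFDerivAt.restrictScalars ℝ
  have h2 := (hq.differentiable (by simp) v).hasFDerivAt.restrictScalars ℝ
  have h3 := (Complex.conjCLE.toContinuousLinearMap.hasFDerivAt (x := q v)).comp v h2
  have h4 := (h1.mul h3).fderiv
  have e : (fun v => p v * (starRingEnd ℂ) (q v)) =
    p * ((Complex.conjCLE.toContinuousLinearMap : ℂ → ℂ) ∘ q) := by
    funext v; simp
  rw [e, h4]
  simp
  ring

/-- The partial derivative. -/
noncomputable def pd {n : ℕ} (i : Fin n) (p : (Fin n → ℂ) → ℂ) (v : Fin n → ℂ) : ℂ :=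
  fderiv ℂ p v (Pi.single i 1)

lemma continuous_pd {n : ℕ} (i : Fin n) {p : (Fin n → ℂ) → ℂ} (hp : ContDiff ℂ 1 p) :
    Continuous (pd i p) :=
  (hp.continuous_fderiv (by simp)).clm_apply continuous_const

section
variable {n : ℕ} (k : Fin n) [MeasurableSpace (Matrix.unitaryGroup (Fin n) ℂ)]
    [BorelSpace (Matrix.unitaryGroup (Fin n) ℂ)]
    (μ : Measure (Matrix.unitaryGroup (Fin n) ℂ))
    [IsProbabilityMeasure μ]

lemma integrable_col {g : (Fin n → ℂ) → ℂ} (hg : Continuous g) :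
    Integrable (fun u => g (col k u)) μ := by
  obtain ⟨B, hB⟩ := exists_bound k hg
  exact Integrable.of_bound (hg.comp (continuous_col k)).aestronglyMeasurable B
    (Filter.Eventually.of_forall hB)

lemma inv_deriv [μ.IsMulLeftInvariant] {g : (Fin n → ℂ) → ℂ} (hg : ContDiff ℝ 1 g)
    (X : Matrix (Fin n) (Fin n) ℂ) (hX : X.conjTranspose = -X) :
    ∫ u, fderiv ℝ g (col k u) (X.mulVec (col k u)) ∂μ = 0 := by
  obtain ⟨W, hW0, hW⟩ := exp_curve X hX
  have hcX : Continuous (fun v : Fin n → ℂ => X.mulVec v) :=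
    Continuous.matrix_mulVec continuous_const continuous_id
  have hc : Continuous (fun v : Fin n → ℂ => fderiv ℝ g v (X.mulVec v)) :=
    (hg.continuous_fderiv (by simp)).clm_apply hcX
  obtain ⟨B, hB⟩ := exists_bound k hc
  have key := hasDerivAt_integral_of_dominated_loc_of_deriv_le (𝕜 := ℝ) (μ := μ)
    (F := fun t u => g (col k (W t * u)))
    (F' := fun t u => fderiv ℝ g (col k (W t * u)) (X.mulVec (col k (W t * u))))
    (x₀ := 0) (s := Set.univ) (bound := fun _ => B) Filter.univ_mem
    (Filter.Eventually.of_forall fun t =>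
      (hg.continuous.comp ((continuous_col k).comp (continuous_const_mul _))).aestronglyMeasurable)
    (by
      simp only [hW0, one_mul]
      exact integrable_col k μ hg.continuous)
    ((hc.comp ((continuous_col k).comp (continuous_const_mul _))).aestronglyMeasurable)
    (Filter.Eventually.of_forall fun u t _ => hB _)
    (integrable_const B)
    (Filter.Eventually.of_forall fun u t _ => by
      simp only [col_mul]
      exact ((hg.differentiable (by simp)) _).hasFDerivAt.comp_hasDerivAt t (hW (col k u) t))
  have h2 := key.2
  have e : (fun t => ∫ u, g (col k (W t * u)) ∂μ) = fun _ => ∫ u, g (col k u) ∂μ := by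
    funext t
    exact integral_mul_left_eq_self (fun u => g (col k u)) (W t)
  rw [e] at h2
  have := h2.unique (hasDerivAt_const _ _)
  simpa only [hW0, one_mul] using this

lemma swap_id [μ.IsMulLeftInvariant] {p q : (Fin n → ℂ) → ℂ} (hp : ContDiff ℂ 1 p)
    (hq : ContDiff ℂ 1 q) (i j : Fin n) :
    ∫ u, pd i p (col k u) * col k u j * (starRingEnd ℂ) (q (col k u)) ∂μ =
      ∫ u, p (col k u) * (starRingEnd ℂ) (col k u i * pd j q (col k u)) ∂μ := by
  have hg : ContDiff ℝ 1 (fun v => p v * (starRingEnd ℂ) (q v)) :=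
    (hp.restrict_scalars ℝ).mul
      (Complex.conjCLE.toContinuousLinearMap.contDiff.comp (hq.restrict_scalars ℝ))
  have A := inv_deriv k μ hg (Matrix.single i j 1 - Matrix.single j i 1) (by simp)
  have B := inv_deriv k μ hg
    (Complex.I • (Matrix.single i j 1 + Matrix.single j i 1)) (by
      rw [Matrix.conjTranspose_smul, Matrix.conjTranspose_add, Matrix.conjTranspose_single,
        Matrix.conjTranspose_single, star_one, add_comm, Complex.star_def, Complex.conj_I,
        neg_smul])
  have ev : ∀ (a b : Fin n) (v : Fin n → ℂ),
      (Matrix.single a b (1 : ℂ)).mulVec v = v b • (Pi.single a 1 : Fin n → ℂ) := by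
    intro a b v
    rw [Matrix.single_mulVec]
    ext c
    by_cases h : c = a
    · subst h; simp
    · simp [h]
  simp only [fderiv_mul_conj hp hq, Matrix.sub_mulVec, Matrix.add_mulVec, Matrix.smul_mulVec, ev,
    map_sub, map_add, map_smul, smul_eq_mul, map_mul, Complex.conj_I] at A B
  have cc := Complex.continuous_conj
  have cj : ∀ j : Fin n, Continuous fun v : Fin n → ℂ => v j := fun j => continuous_apply j
  have c1 := continuous_pd i hp
  have c2 := continuous_pd j hp
  have c3 := continuous_pd i hq
  have c4 := continuous_pd j hq
  have cp := hp.continuous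
  have cq := hq.continuous
  -- the difference of both sides
  rw [← sub_eq_zero, ← integral_sub]
  · have B' := congrArg (fun z => -Complex.I * z) B
    simp only [← integral_const_mul, mul_zero] at B'
    have S := congrArg₂ (· + ·) A B'
    simp only [add_zero] at S
    rw [← integral_add] at S
    · have : (2 : ℂ) * ∫ u, (pd i p (col k u) * col k u j * (starRingEnd ℂ) (q (col k u)) -
        p (col k u) * (starRingEnd ℂ) (col k u i * pd j q (col k u))) ∂μ = 0 := by
        rw [← integral_const_mul, ← S]
        refine integral_congr_ae (Filter.Eventually.of_forall fun u => ?_)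
        simp only [pd, map_mul]
        ring_nf
        simp only [Complex.I_sq]
        ring
      simpa using this
    · refine integrable_col k μ (g := fun v => (v j * pd i p v - v i * pd j p v) * (starRingEnd ℂ) (q v)
        + p v * ((starRingEnd ℂ) (v j) * (starRingEnd ℂ) (pd i q v) -
          (starRingEnd ℂ) (v i) * (starRingEnd ℂ) (pd j q v))) ?_
      fun_prop
    · refine integrable_col k μ (g := fun v => -Complex.I *
        (Complex.I * (v j * pd i p v + v i * pd j p v) * (starRingEnd ℂ) (q v)
        + p v * (-Complex.I * ((starRingEnd ℂ) (v j) * (starRingEnd ℂ) (pd i q v) +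
          (starRingEnd ℂ) (v i) * (starRingEnd ℂ) (pd j q v))))) ?_
      fun_prop
  · exact integrable_col k μ (g := fun v => pd i p v * v j * (starRingEnd ℂ) (q v)) (by fun_prop)
  · exact integrable_col k μ (g := fun v => p v * (starRingEnd ℂ) (v i * pd j q v)) (by fun_prop)

lemma ibp [μ.IsMulLeftInvariant] {p q : (Fin n → ℂ) → ℂ} (hp : ContDiff ℂ 1 p)
    (hq : ContDiff ℂ 1 q) (d : ℕ) (hd : ∀ v, ∑ j, v j * pd j q v = d * q v) (i : Fin n) :
    (n + d : ℂ) * ∫ u, p (col k u) * (starRingEnd ℂ) (col k u i * q (col k u)) ∂μ =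
      ∫ u, pd i p (col k u) * (starRingEnd ℂ) (q (col k u)) ∂μ := by
  have cj : ∀ j : Fin n, ContDiff ℂ 1 fun v : Fin n → ℂ => v j := fun j => contDiff_apply ℂ ℂ j
  have cc := Complex.continuous_conj
  have cj' : ∀ j : Fin n, Continuous fun v : Fin n → ℂ => v j := fun j => continuous_apply j
  have c1 := continuous_pd i hp
  have c4 := fun j => continuous_pd j hq
  have cp := hp.continuous
  have cq := hq.continuous
  have h := fun j => swap_id k μ hp ((cj j).mul hq) i j
  have hpd : ∀ j v, pd j (fun v => v j * q v) v = q v + v j * pd j q v := by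
    intro j v
    have h1 := (ContinuousLinearMap.proj (R := ℂ) (φ := fun _ : Fin n => ℂ) j).hasFDerivAt (x := v)
    have h2 := (hq.differentiable (by simp) v).hasFDerivAt
    have h3 := (h1.mul h2).fderiv
    have e : (fun v : Fin n → ℂ => v j * q v) =
      (ContinuousLinearMap.proj (R := ℂ) (φ := fun _ : Fin n => ℂ) j : (Fin n → ℂ) → ℂ) * q := by
      funext v; simp
    unfold pd
    rw [e, h3]
    simp
    ring
  simp only [hpd] at h
  have hs := Finset.sum_congr (rfl : (Finset.univ : Finset (Fin n)) = Finset.univ) (fun j _ => h j)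
  rw [← integral_finsetSum, ← integral_finsetSum] at hs
  · rw [← integral_const_mul]
    refine Eq.trans ?_ (hs.symm.trans ?_)
    · refine integral_congr_ae (Filter.Eventually.of_forall fun u => ?_)
      simp only
      rw [← Finset.mul_sum, ← map_sum, ← Finset.mul_sum, Finset.sum_add_distrib, hd]
      simp
      ring
    · refine integral_congr_ae (Filter.Eventually.of_forall fun u => ?_)
      simp only [map_mul]
      calc _ = pd i p (col k u) * (starRingEnd ℂ) (q (col k u)) *
            ∑ i, (col k u i) * (starRingEnd ℂ) (col k u i) := by
            rw [Finset.mul_sum]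
            exact Finset.sum_congr rfl fun j _ => by ring
        _ = _ := by rw [sum_col, mul_one]
  · intro j _
    have := c4 j
    exact integrable_col k μ (g := fun v => p v * (starRingEnd ℂ) (v i * (q v + v j * pd j q v)))
      (by fun_prop)
  · intro j _
    exact integrable_col k μ (g := fun v => pd i p v * v j * (starRingEnd ℂ) (v j * q v))
      (by fun_prop)
end


/-- The homogeneous polynomial attached to a tensor. -/
noncomputable def P {n d : ℕ} (A : (Fin d → Fin n) → ℂ) (v : Fin n → ℂ) : ℂ :=
  ∑ I, A I * ∏ s, v (I s)

lemma contDiff_P {n d : ℕ} (A : (Fin d → Fin n) → ℂ) : ContDiff ℂ 1 (P A) := by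
  unfold P
  refine ContDiff.sum fun I _ => contDiff_const.mul (contDiff_prod fun s _ => contDiff_apply ℂ ℂ _)

/-- Contraction of a tensor in one slot. -/
def ctr {n d : ℕ} (A : (Fin (d + 1) → Fin n) → ℂ) (s : Fin (d + 1)) (j : Fin n) :
    (Fin d → Fin n) → ℂ := fun I => A (s.insertNth j I)

lemma sum_insertNth {n d : ℕ} {M : Type*} [AddCommMonoid M] (f : (Fin (d + 1) → Fin n) → M)
    (s : Fin (d + 1)) :
    ∑ I, f I = ∑ j, ∑ I : Fin d → Fin n, f (s.insertNth j I) := by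
  rw [← Fintype.sum_prod_type']
  exact (Fintype.sum_equiv (Fin.insertNthEquiv (fun _ => Fin n) s) _ _ (fun x => rfl)).symm

lemma P_split {n d : ℕ} (A : (Fin (d + 1) → Fin n) → ℂ) (s : Fin (d + 1)) (v : Fin n → ℂ) :
    P A v = ∑ j, v j * P (ctr A s j) v := by
  unfold P ctr
  rw [sum_insertNth _ s]
  refine Finset.sum_congr rfl fun j _ => ?_
  rw [Finset.mul_sum]
  refine Finset.sum_congr rfl fun I _ => ?_
  rw [Fin.prod_univ_succAbove _ s]
  simp only [Fin.insertNth_apply_same, Fin.insertNth_apply_succAbove]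
  ring

lemma pd_P {n d : ℕ} (A : (Fin (d + 1) → Fin n) → ℂ) (j : Fin n) (v : Fin n → ℂ) :
    pd j (P A) v = ∑ s, P (ctr A s j) v := by
  have h : HasFDerivAt (P A) (∑ I, A I • ∑ s, (∏ r ∈ Finset.univ.erase s, v (I r)) •
      (ContinuousLinearMap.proj (R := ℂ) (φ := fun _ : Fin n => ℂ) (I s))) v := by
    unfold P
    refine HasFDerivAt.fun_sum fun I _ => ?_
    refine HasFDerivAt.const_mul ?_ _
    refine HasFDerivAt.finsetProd fun s _ => ?_
    exact (ContinuousLinearMap.proj (R := ℂ) (φ := fun _ : Fin n => ℂ) (I s)).hasFDerivAt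
  unfold pd
  rw [h.fderiv]
  simp only [_root_.sum_apply, _root_.smul_apply,
    ContinuousLinearMap.proj_apply, smul_eq_mul, Finset.mul_sum]
  rw [Finset.sum_comm]
  refine Finset.sum_congr rfl fun s _ => ?_
  rw [sum_insertNth _ s, Finset.sum_eq_single j]
  · unfold P ctr
    refine Finset.sum_congr rfl fun I _ => ?_
    have : ∏ r ∈ Finset.univ.erase s, v ((s.insertNth j I : Fin (d + 1) → Fin n) r) =
        ∏ r, v (I r) := by
      have e : (Finset.univ.erase s : Finset (Fin (d + 1))) =
          Finset.univ.map s.succAboveEmb := by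
        ext r
        simp only [Finset.mem_erase, Finset.mem_univ, and_true, Finset.mem_map, true_and]
        exact Fin.exists_succAbove_eq_iff.symm
      rw [e, Finset.prod_map]
      refine Finset.prod_congr rfl fun r _ => ?_
      simp
    rw [this]
    simp
  · intro b _ hb
    refine Finset.sum_eq_zero fun I _ => ?_
    simp [hb]
  · simp

lemma euler_P {n d : ℕ} (A : (Fin d → Fin n) → ℂ) (v : Fin n → ℂ) :
    ∑ j, v j * pd j (P A) v = d * P A v := by
  cases d with
  | zero =>
    have : P A = fun _ => A Fin.elim0 := by
      funext w
      unfold P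
      simp
      rw [Subsingleton.elim (default : Fin 0 → Fin n) Fin.elim0]
    rw [this]
    simp [pd]
  | succ d =>
    simp only [pd_P, Finset.mul_sum]
    rw [Finset.sum_comm]
    simp only [← P_split]
    simp

section
variable {n : ℕ} (k : Fin n) [MeasurableSpace (Matrix.unitaryGroup (Fin n) ℂ)]
    [BorelSpace (Matrix.unitaryGroup (Fin n) ℂ)]
    (μ : Measure (Matrix.unitaryGroup (Fin n) ℂ))
    [IsProbabilityMeasure μ]

lemma integrable_sq {g : (Fin n → ℂ) → ℂ} (hg : Continuous g) :
    Integrable (fun u => ‖g (col k u)‖ ^ 2) μ := by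
  have := (integrable_col k μ (g := fun v => g v ^ 2) (by fun_prop)).norm
  simpa using this

lemma norm_inner_le {f g : (Fin n → ℂ) → ℂ} (hf : Continuous f) (hg : Continuous g) :
    ‖∫ u, f (col k u) * (starRingEnd ℂ) (g (col k u)) ∂μ‖ ≤
      ((∫ u, ‖f (col k u)‖ ^ 2 ∂μ) + ∫ u, ‖g (col k u)‖ ^ 2 ∂μ) / 2 := by
  rw [← integral_add (integrable_sq k μ hf) (integrable_sq k μ hg), ← integral_div]
  refine (norm_integral_le_integral_norm _).trans (integral_mono ?_ ?_ ?_)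
  · have cc := Complex.continuous_conj
    exact (integrable_col k μ (g := fun v => f v * (starRingEnd ℂ) (g v)) (by fun_prop)).norm
  · exact ((integrable_sq k μ hf).add (integrable_sq k μ hg)).div_const 2
  · intro u
    simp only [norm_mul, RCLike.norm_conj]
    nlinarith [sq_nonneg (‖f (col k u)‖ - ‖g (col k u)‖)]

lemma moment [μ.IsMulLeftInvariant] (d : ℕ) : ∀ (A : (Fin d → Fin n) → ℂ),
    ∫ u, ‖P A (col k u)‖ ^ 2 ∂μ ≤ (d.factorial / (n : ℝ) ^ d) * ∑ I, ‖A I‖ ^ 2 := by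
  have hn : (0 : ℝ) < n := by
    have := k.pos
    exact_mod_cast this
  induction d with
  | zero =>
    intro A
    simp [P]
  | succ d ih =>
    intro A
    set K : ℝ := d.factorial / (n : ℝ) ^ d with hK
    have cc := Complex.continuous_conj
    have cP : ∀ {e : ℕ} (B : (Fin e → Fin n) → ℂ), Continuous (P B) := fun B =>
      (contDiff_P B).continuous
    have cj : ∀ j : Fin n, Continuous fun v : Fin n → ℂ => v j := fun j => continuous_apply j
    have h1 : ((∫ u, ‖P A (col k u)‖ ^ 2 ∂μ : ℝ) : ℂ) = ∑ j, ∫ u, P A (col k u) *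
        (starRingEnd ℂ) (col k u j * P (ctr A 0 j) (col k u)) ∂μ := by
      rw [← integral_finsetSum, ← integral_complex_ofReal]
      · refine integral_congr_ae (Filter.Eventually.of_forall fun u => ?_)
        simp only
        rw [← Finset.mul_sum, ← map_sum, ← P_split, Complex.mul_conj, Complex.normSq_eq_norm_sq]
      · intro j _
        have := cP (ctr A 0 j)
        have := cP A
        exact integrable_col k μ
          (g := fun v => P A v * (starRingEnd ℂ) (v j * P (ctr A 0 j) v)) (by fun_prop)
    have h2 : (n + d : ℂ) * ((∫ u, ‖P A (col k u)‖ ^ 2 ∂μ : ℝ) : ℂ) = ∑ j, ∑ s, ∫ u,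
        P (ctr A s j) (col k u) * (starRingEnd ℂ) (P (ctr A 0 j) (col k u)) ∂μ := by
      rw [h1, Finset.mul_sum]
      refine Finset.sum_congr rfl fun j _ => ?_
      rw [ibp k μ (contDiff_P A) (contDiff_P (ctr A 0 j)) d (euler_P _) j, ← integral_finsetSum]
      · simp only [pd_P, Finset.sum_mul]
      · intro s _
        have := cP (ctr A 0 j)
        have := cP (ctr A s j)
        exact integrable_col k μ
          (g := fun v => P (ctr A s j) v * (starRingEnd ℂ) (P (ctr A 0 j) v)) (by fun_prop)
    have h3 := congrArg norm h2
    have hI : 0 ≤ ∫ u, ‖P A (col k u)‖ ^ 2 ∂μ := integral_nonneg fun u => by positivity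
    have h4 : ‖(n + d : ℂ) * ((∫ u, ‖P A (col k u)‖ ^ 2 ∂μ : ℝ) : ℂ)‖ =
        (n + d) * ∫ u, ‖P A (col k u)‖ ^ 2 ∂μ := by
      rw [norm_mul, Complex.norm_real, Real.norm_of_nonneg hI]
      congr 1
      exact_mod_cast Complex.norm_natCast (n + d)
    rw [h4] at h3
    have hctr : ∀ s, ∑ j, ∑ I, ‖ctr A s j I‖ ^ 2 = ∑ I, ‖A I‖ ^ 2 := fun s =>
      (sum_insertNth (fun I => ‖A I‖ ^ 2) s).symm
    have h5 : (n + d) * ∫ u, ‖P A (col k u)‖ ^ 2 ∂μ ≤ (d + 1) * (K * ∑ I, ‖A I‖ ^ 2) := by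
      rw [h3]
      calc _ ≤ ∑ j, ∑ s, (K * (∑ I, ‖ctr A s j I‖ ^ 2) + K * (∑ I, ‖ctr A 0 j I‖ ^ 2)) / 2 := by
            refine (norm_sum_le _ _).trans (Finset.sum_le_sum fun j _ => ?_)
            refine (norm_sum_le _ _).trans (Finset.sum_le_sum fun s _ => ?_)
            refine (norm_inner_le k μ (cP _) (cP _)).trans ?_
            have := ih (ctr A s j)
            have := ih (ctr A 0 j)
            linarith
        _ = ∑ s : Fin (d + 1), K * ∑ I, ‖A I‖ ^ 2 := by
            rw [Finset.sum_comm]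
            refine Finset.sum_congr rfl fun s _ => ?_
            rw [← Finset.sum_div, Finset.sum_add_distrib, ← Finset.mul_sum, ← Finset.mul_sum,
              hctr, hctr]
            ring
        _ = _ := by simp
    have h6 : n * ∫ u, ‖P A (col k u)‖ ^ 2 ∂μ ≤ (d + 1) * (K * ∑ I, ‖A I‖ ^ 2) := by
      refine le_trans ?_ h5
      have : (0 : ℝ) ≤ d := by positivity
      nlinarith
    have e : ((d + 1).factorial / (n : ℝ) ^ (d + 1)) * ∑ I, ‖A I‖ ^ 2 =
        ((d + 1) * (K * ∑ I, ‖A I‖ ^ 2)) / n := by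
      rw [hK, Nat.factorial_succ]
      push_cast
      field_simp
      ring
    rw [e, le_div_iff₀ hn, mul_comm]
    exact h6

end

lemma tensor_pow {n : ℕ} (α : Matrix (Fin n) (Fin n) ℂ) (C : ℝ)
    (hHS : ∑ i, ∑ j, ‖α i j‖ ^ 2 ≤ C) (m : ℕ) :
    ∃ A : (Fin (2 * m) → Fin n) → ℂ, (∀ v, P A v = (∑ i, ∑ j, α i j * v i * v j) ^ m) ∧
      ∑ I, ‖A I‖ ^ 2 ≤ C ^ m := by
  have hC : 0 ≤ C := le_trans (by positivity) hHS
  induction m with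
  | zero => exact ⟨fun _ => 1, fun v => by simp [P], by simp⟩
  | succ m ih =>
    obtain ⟨A, hA, hA2⟩ := ih
    let B : (Fin (2 * m + 1 + 1) → Fin n) → ℂ :=
      fun I => α (I 0) (I 1) * A (fun r => I r.succ.succ)
    have hB : ∀ i j, ctr (ctr B 0 i) 0 j = fun I => α i j * A I := by
      intro i j
      funext I
      simp only [ctr, B, Fin.insertNth_zero', Fin.cons_zero, Fin.cons_succ]
      rfl
    refine ⟨B, fun v => ?_, ?_⟩
    · rw [P_split B 0]
      simp only [P_split (ctr B 0 _) 0, hB]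
      have : ∀ c : ℂ, P (fun I => c * A I) v = c * P A v := by
        intro c
        simp only [P, Finset.mul_sum, mul_assoc]
      simp only [this, hA]
      rw [pow_succ', Finset.sum_mul]
      refine Finset.sum_congr rfl fun i _ => ?_
      rw [Finset.sum_mul, Finset.mul_sum]
      exact Finset.sum_congr rfl fun j _ => by ring
    · have : ∑ I, ‖B I‖ ^ 2 = (∑ i, ∑ j, ‖α i j‖ ^ 2) * ∑ I, ‖A I‖ ^ 2 := by
        rw [sum_insertNth _ 0, Finset.sum_mul]
        refine Finset.sum_congr rfl fun i _ => ?_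
        rw [sum_insertNth _ 0, Finset.sum_mul]
        refine Finset.sum_congr rfl fun j _ => ?_
        rw [Finset.mul_sum]
        refine Finset.sum_congr rfl fun I _ => ?_
        have := congrFun (hB i j) I
        simp only [ctr] at this
        rw [this, norm_mul, mul_pow]
      refine this.le.trans ?_
      rw [pow_succ']
      exact mul_le_mul hHS hA2 (by positivity) hC

lemma num_bound (x : ℝ) (hx : 0 < x) :
    ∃ m : ℕ, ((2 * m).factorial : ℝ) / x ^ (2 * m) ≤ 6 * Real.exp (-(x / 32)) := by
  refine ⟨⌊x / 4⌋₊, ?_⟩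
  set m := ⌊x / 4⌋₊
  have h1 : (m : ℝ) ≤ x / 4 := Nat.floor_le (by positivity)
  have h2 : x / 4 < m + 1 := Nat.lt_floor_add_one _
  have h3 : ((2 * m).factorial : ℝ) ≤ (x / 2) ^ (2 * m) := by
    calc ((2 * m).factorial : ℝ) ≤ ((2 * m : ℕ) : ℝ) ^ (2 * m) := by
          exact_mod_cast Nat.factorial_le_pow _
      _ ≤ _ := by
          refine pow_le_pow_left₀ (by positivity) ?_ _
          push_cast
          linarith
  have h4 : ((2 * m).factorial : ℝ) / x ^ (2 * m) ≤ (1 / 4) ^ m := by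
    rw [div_le_iff₀ (by positivity)]
    refine h3.trans (le_of_eq ?_)
    rw [div_pow, pow_mul (2 : ℝ), div_pow, one_pow]
    norm_num
    ring
  have h5 : (1 / 4 : ℝ) ≤ Real.exp (-1) := by
    rw [Real.exp_neg, one_div]
    refine inv_anti₀ (Real.exp_pos _) ?_
    linarith [Real.exp_one_lt_d9]
  have h6 : (1 / 4 : ℝ) ^ (m + 1) ≤ Real.exp (-(x / 32)) := by
    calc (1 / 4 : ℝ) ^ (m + 1) ≤ Real.exp (-1) ^ (m + 1) :=
          pow_le_pow_left₀ (by norm_num) h5 _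
      _ = Real.exp (((m + 1 : ℕ) : ℝ) * (-1)) := (Real.exp_nat_mul _ _).symm
      _ ≤ _ := by
          refine Real.exp_le_exp.2 ?_
          push_cast
          linarith
  rw [pow_succ] at h6
  have : 0 < Real.exp (-(x / 32)) := Real.exp_pos _
  linarith

end HaarCol

/-- Concentration for `Re ∑ α_{ij} conj(u_{ik}) conj(u_{jk})` under a Haar-random unitary
`u ∈ U(n)`. -/
theorem stmt_11 (n : ℕ) (hn : 1 ≤ n)
    (C : ℝ) (hC : 0 < C)
    (α : Matrix (Fin n) (Fin n) ℂ)
    (hHS : ∑ i, ∑ j, ‖α i j‖ ^ 2 ≤ C)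
    (k : Fin n) (T : ℝ) (hT : 0 < T)
    [MeasurableSpace (Matrix.unitaryGroup (Fin n) ℂ)]
    [BorelSpace (Matrix.unitaryGroup (Fin n) ℂ)]
    (μ : Measure (Matrix.unitaryGroup (Fin n) ℂ))
    [μ.IsMulLeftInvariant] [IsProbabilityMeasure μ] :
    μ {u : Matrix.unitaryGroup (Fin n) ℂ |
        T ≤ |(∑ i, ∑ j, α i j * (starRingEnd ℂ) (u i k) * (starRingEnd ℂ) (u j k)).re|} ≤
      ENNReal.ofReal (6 * Real.exp (-(n * T / (32 * Real.sqrt C))) +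
        2 * Real.exp (-(n : ℝ) / 6)) := by
  have hn' : (0 : ℝ) < n := by exact_mod_cast hn
  have hs : 0 < Real.sqrt C := Real.sqrt_pos.2 hC
  obtain ⟨m, hm⟩ := HaarCol.num_bound (n * T / Real.sqrt C) (by positivity)
  obtain ⟨A, hA, hA2⟩ := HaarCol.tensor_pow (α.map (starRingEnd ℂ)) C
    (by simpa using hHS) m
  have hmom := HaarCol.moment k μ (2 * m) A
  have hsub : {u : Matrix.unitaryGroup (Fin n) ℂ |
        T ≤ |(∑ i, ∑ j, α i j * (starRingEnd ℂ) (u i k) * (starRingEnd ℂ) (u j k)).re|} ⊆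
      {u | T ^ (2 * m) ≤ ‖HaarCol.P A (HaarCol.col k u)‖ ^ 2} := by
    intro u hu
    simp only [Set.mem_ofPred_eq] at hu ⊢
    have e : ∑ i, ∑ j, α.map (starRingEnd ℂ) i j * HaarCol.col k u i * HaarCol.col k u j =
        (starRingEnd ℂ)
          (∑ i, ∑ j, α i j * (starRingEnd ℂ) (u i k) * (starRingEnd ℂ) (u j k)) := by
      simp [HaarCol.col]
    rw [hA, e, norm_pow, RCLike.norm_conj, ← pow_mul, mul_comm m 2]
    exact pow_le_pow_left₀ hT.le (hu.trans (Complex.abs_re_le_norm _)) _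
  have hmk := mul_meas_ge_le_integral_of_nonneg (μ := μ)
    (f := fun u => ‖HaarCol.P A (HaarCol.col k u)‖ ^ 2)
    (Filter.Eventually.of_forall fun u => by positivity)
    (HaarCol.integrable_sq k μ (HaarCol.contDiff_P A).continuous) (T ^ (2 * m))
  have hfin : μ.real {u | T ^ (2 * m) ≤ ‖HaarCol.P A (HaarCol.col k u)‖ ^ 2} ≤
      6 * Real.exp (-(n * T / (32 * Real.sqrt C))) := by
    have e1 : n * T / Real.sqrt C / 32 = n * T / (32 * Real.sqrt C) := by
      rw [div_div, mul_comm (32 : ℝ)]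
    rw [e1] at hm
    refine le_trans ?_ hm
    have e2 : (n * T / Real.sqrt C) ^ (2 * m) = n ^ (2 * m) * T ^ (2 * m) / C ^ m := by
      rw [div_pow, mul_pow, pow_mul (Real.sqrt C), Real.sq_sqrt hC.le]
    rw [e2]
    have h1 : T ^ (2 * m) * μ.real {u | T ^ (2 * m) ≤ ‖HaarCol.P A (HaarCol.col k u)‖ ^ 2} ≤
        ((2 * m).factorial / (n : ℝ) ^ (2 * m)) * C ^ m :=
      hmk.trans (hmom.trans (mul_le_mul_of_nonneg_left hA2 (by positivity)))
    have hTp : 0 < T ^ (2 * m) := by positivity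
    rw [mul_comm, ← le_div_iff₀ hTp] at h1
    refine h1.trans (le_of_eq ?_)
    field_simp
  calc _ ≤ μ {u | T ^ (2 * m) ≤ ‖HaarCol.P A (HaarCol.col k u)‖ ^ 2} := measure_mono hsub
    _ = ENNReal.ofReal (μ.real {u | T ^ (2 * m) ≤ ‖HaarCol.P A (HaarCol.col k u)‖ ^ 2}) :=
        (ofReal_measureReal).symm
    _ ≤ _ := by
        refine ENNReal.ofReal_le_ofReal (hfin.trans ?_)
        have : 0 < Real.exp (-(n : ℝ) / 6) := Real.exp_pos _
        linarith
end

section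
/- Let n ≥ 1, C > 0, and let B be an n×n real matrix with trace zero and Σ_{i,j} B_{ij}² ≤ C. Fix 1 ≤ k ≤ n and let T > 0. Then for a Haar-random orthogonal matrix o ∈ O(n), P(|Σ_{i,j} o_{ik}·B_{ij}·o_{jk}| ≥ T) ≤ 6·exp(−n·T/(32·√C)) + 2·exp(−n/12). -/
open MeasureTheory

namespace HWaux
open ProbabilityTheory Matrix

abbrev On (n : ℕ) := Matrix.orthogonalGroup (Fin n) ℝ

instance (n : ℕ) : SecondCountableTopology (On n) :=
  haveI : SecondCountableTopology (Matrix (Fin n) (Fin n) ℝ) :=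
    inferInstanceAs (SecondCountableTopology (Fin n → Fin n → ℝ))
  Topology.IsInducing.subtypeVal.secondCountableTopology

noncomputable abbrev P (n : ℕ) : Measure (Fin n → ℝ) := Measure.pi (fun _ => gaussianReal 0 1)

def Q {n : ℕ} (B : Matrix (Fin n) (Fin n) ℝ) (v : Fin n → ℝ) : ℝ := v ⬝ᵥ (B *ᵥ v)

lemma lint_right {G : Type*} [Group G] [TopologicalSpace G] [IsTopologicalGroup G]
    [SecondCountableTopology G] [MeasurableSpace G] [BorelSpace G]
    (μ : Measure G) [μ.IsMulLeftInvariant] [IsProbabilityMeasure μ]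
    (f : G → ENNReal) (hf : Measurable f) (h : G) : ∫⁻ o, f (o * h) ∂μ = ∫⁻ o, f o ∂μ := by
  have key : ∀ φ : G → ENNReal, Measurable φ → ∫⁻ o, φ o ∂μ = ∫⁻ o, φ o⁻¹ ∂μ := by
    intro φ hφ
    calc ∫⁻ o, φ o ∂μ = ∫⁻ p, ∫⁻ o, φ (p⁻¹ * o) ∂μ ∂μ := by
          simp [lintegral_mul_left_eq_self]
      _ = ∫⁻ o, ∫⁻ p, φ (p⁻¹ * o) ∂μ ∂μ := by
          apply lintegral_lintegral_swap
          apply Measurable.aemeasurable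
          apply hφ.comp
          fun_prop
      _ = ∫⁻ o, ∫⁻ p, φ p⁻¹ ∂μ ∂μ := by
          congr 1
          ext o
          rw [← lintegral_mul_left_eq_self (fun p => φ (p⁻¹ * o)) o]
          simp
      _ = _ := by simp
  rw [key _ (by fun_prop), key _ hf, ← lintegral_mul_left_eq_self (fun o => f (o⁻¹)) h⁻¹]
  simp

lemma rot {n : ℕ} (U : On n) : MeasurePreserving (fun v => (U : Matrix (Fin n) (Fin n) ℝ) *ᵥ v) (P n) (P n) := by
  have hU : (U : Matrix (Fin n) (Fin n) ℝ)ᵀ * U = 1 := by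
    have := (Matrix.mem_orthogonalGroup_iff' (Fin n) ℝ).1 U.2
    exact this
  let L : EuclideanSpace ℝ (Fin n) →ₗᵢ[ℝ] EuclideanSpace ℝ (Fin n) :=
    ⟨Matrix.toEuclideanLin (U : Matrix (Fin n) (Fin n) ℝ), fun x => by
      have h2 : ∀ y : EuclideanSpace ℝ (Fin n), ‖y‖ ^ 2 = y.ofLp ⬝ᵥ y.ofLp := by
        intro y
        rw [EuclideanSpace.real_norm_sq_eq]
        simp [dotProduct, sq]
      have h3 : ‖Matrix.toEuclideanLin (U : Matrix (Fin n) (Fin n) ℝ) x‖ ^ 2 = ‖x‖ ^ 2 := by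
        rw [h2, h2]
        simp only [Matrix.ofLp_toLpLin, Matrix.toLin'_apply]
        rw [dotProduct_mulVec, vecMul_mulVec, hU]
        simp [dotProduct_comm]
      exact (sq_eq_sq₀ (norm_nonneg _) (norm_nonneg _)).1 h3⟩
  let Le := L.toLinearIsometryEquiv rfl
  have e := stdGaussian_map Le
  refine ⟨by fun_prop, ?_⟩
  have hP : P n = (stdGaussian (EuclideanSpace ℝ (Fin n))).map (WithLp.ofLp) := by
    rw [← map_pi_eq_stdGaussian, Measure.map_map (by fun_prop) (by fun_prop)]
    simp [Function.comp_def]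
  conv_rhs => rw [hP, ← e, Measure.map_map (by fun_prop) (by fun_prop)]
  rw [hP, Measure.map_map (by fun_prop) (by fun_prop)]
  rfl

lemma house {n : ℕ} (k : Fin n) (g : Fin n → ℝ) : ∃ h : On n, ∃ r : ℝ, r ^ 2 = ∑ i, g i ^ 2 ∧
    g = r • ((h : Matrix (Fin n) (Fin n) ℝ) *ᵥ (Pi.single k 1)) := by
  let w : EuclideanSpace ℝ (Fin n) := WithLp.toLp 2 g
  let r := ‖w‖
  let v : EuclideanSpace ℝ (Fin n) := r • EuclideanSpace.single k 1
  have hvw : ‖v‖ = ‖w‖ := by simp [v, r, norm_smul]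
  let ρ := (ℝ ∙ (v - w))ᗮ.reflection
  have hρ : ρ v = w := Submodule.reflection_sub hvw
  let b := EuclideanSpace.basisFun (Fin n) ℝ
  refine ⟨⟨_, ρ.toMatrix_mem_unitaryGroup b b⟩, r, ?_, ?_⟩
  · simp only [r]; rw [EuclideanSpace.real_norm_sq_eq]
  · have h1 : w = r • ρ (EuclideanSpace.single k 1) := by
      rw [← hρ, map_smul]
    ext i
    have h2 : g i = w i := rfl
    rw [h2, h1]
    simp [b, LinearMap.toMatrix_apply]

lemma diagz {n : ℕ} (B : Matrix (Fin n) (Fin n) ℝ) (htr : B.trace = 0) (C : ℝ)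
    (hHS : ∑ i, ∑ j, B i j ^ 2 ≤ C) : ∃ (U : On n) (d : Fin n → ℝ),
    (∀ v, Q B ((U : Matrix (Fin n) (Fin n) ℝ) *ᵥ v) = ∑ i, d i * v i ^ 2) ∧ ∑ i, d i = 0 ∧ ∑ i, d i ^ 2 ≤ C := by
  let A : Matrix (Fin n) (Fin n) ℝ := (1/2 : ℝ) • (B + Bᵀ)
  have hA : A.IsHermitian := by
    ext i j
    simp [A, add_comm]
  have hQ : ∀ v, Q B v = Q A v := by
    intro v
    have : v ⬝ᵥ (Bᵀ *ᵥ v) = v ⬝ᵥ (B *ᵥ v) := by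
      rw [mulVec_transpose, dotProduct_comm, ← dotProduct_mulVec]
    simp [Q, A, smul_mulVec, add_mulVec, this]
    ring
  let U := hA.eigenvectorUnitary
  let D : Matrix (Fin n) (Fin n) ℝ := diagonal hA.eigenvalues
  have hU : (U : Matrix (Fin n) (Fin n) ℝ)ᵀ * U = 1 :=
    (Matrix.mem_orthogonalGroup_iff' (Fin n) ℝ).1 U.2
  have hs : A = U * D * (U : Matrix (Fin n) (Fin n) ℝ)ᵀ := by
    have := hA.spectral_theorem
    rw [Unitary.conjStarAlgAut_apply] at this
    exact this
  have hs' : (U : Matrix (Fin n) (Fin n) ℝ)ᵀ * A * U = D := by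
    rw [hs]
    calc _ = ((U : Matrix (Fin n) (Fin n) ℝ)ᵀ * U) * D * ((U : Matrix (Fin n) (Fin n) ℝ)ᵀ * U) := by
          simp only [Matrix.mul_assoc]
      _ = D := by rw [hU]; simp
  refine ⟨U, hA.eigenvalues, ?_, ?_, ?_⟩
  · intro v
    rw [hQ, Q, mulVec_mulVec, dotProduct_mulVec, vecMul_mulVec, ← Matrix.mul_assoc, hs']
    simp [D, dotProduct, vecMul_diagonal]
    exact Finset.sum_congr rfl fun i _ => by ring
  · have := hA.trace_eq_sum_eigenvalues
    have h0 : A.trace = 0 := by simp [A, htr]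
    rw [h0] at this
    exact this.symm
  · have h1 : (A * A).trace = ∑ i, hA.eigenvalues i ^ 2 := by
      have : A * A = U * (D * D) * (U : Matrix (Fin n) (Fin n) ℝ)ᵀ := by
        calc A * A = (U * D * (U : Matrix (Fin n) (Fin n) ℝ)ᵀ) * (U * D * (U : Matrix (Fin n) (Fin n) ℝ)ᵀ) := by
              rw [← hs]
          _ = U * D * ((U : Matrix (Fin n) (Fin n) ℝ)ᵀ * U) * D * (U : Matrix (Fin n) (Fin n) ℝ)ᵀ := by
              simp only [Matrix.mul_assoc]
          _ = _ := by rw [hU]; simp only [Matrix.mul_assoc, Matrix.mul_one]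
      rw [this, Matrix.trace_mul_comm, ← Matrix.mul_assoc, hU]
      simp [D, Matrix.trace, sq]
    rw [← h1]
    refine le_trans ?_ hHS
    have h2 : (A * A).trace = ∑ i, ∑ j, ((1/2 : ℝ) * (B i j + B j i)) ^ 2 := by
      simp only [Matrix.trace, Matrix.diag, Matrix.mul_apply]
      refine Finset.sum_congr rfl fun i _ => Finset.sum_congr rfl fun j _ => ?_
      simp [A]
      ring
    have h3 : ∑ i, ∑ j, B i j ^ 2 = ∑ i, ∑ j, (1/2 : ℝ) * (B i j ^ 2 + B j i ^ 2) := by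
      have := Finset.sum_comm (s := Finset.univ) (t := Finset.univ) (f := fun i j => B i j ^ 2)
      simp only [← Finset.mul_sum, Finset.sum_add_distrib]
      rw [← this]; ring
    rw [h2, h3]
    refine Finset.sum_le_sum fun i _ => Finset.sum_le_sum fun j _ => ?_
    nlinarith [sq_nonneg (B i j - B j i)]

lemma oned (c : ℝ) (hc : |c| ≤ 1 / 4) :
    Integrable (fun x => Real.exp (c * x ^ 2)) (gaussianReal 0 1) ∧
    ∫ x, Real.exp (c * x ^ 2) ∂(gaussianReal 0 1) ≤ Real.exp (c + 4 * c ^ 2) := by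
  obtain ⟨hc1, hc2⟩ := abs_le.1 hc
  have hb : 0 < 1 / 2 - c := by linarith
  have e : ∀ x : ℝ, gaussianPDFReal 0 1 x • Real.exp (c * x ^ 2)
      = (√(2 * Real.pi))⁻¹ * Real.exp (-(1 / 2 - c) * x ^ 2) := by
    intro x
    simp only [gaussianPDFReal, smul_eq_mul]
    rw [mul_assoc, ← Real.exp_add]
    simp
    left; ring
  constructor
  · rw [gaussianReal_of_var_ne_zero _ one_ne_zero,
      integrable_withDensity_iff_integrable_smul' (by fun_prop) (by simp [gaussianPDF])]
    simp only [toReal_gaussianPDF, e]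
    exact (integrable_exp_neg_mul_sq hb).const_mul _
  · rw [integral_gaussianReal_eq_integral_smul one_ne_zero]
    simp only [e]
    rw [integral_const_mul, integral_gaussian]
    have h1 : (√(2 * Real.pi))⁻¹ * √(Real.pi / (1 / 2 - c)) = √((1 - 2 * c)⁻¹) := by
      rw [← Real.sqrt_inv, ← Real.sqrt_mul (by positivity)]
      congr 1
      have := Real.pi_pos.ne'
      have h3 : 1 - 2 * c ≠ 0 := by linarith
      have h4 : 1 / 2 - c ≠ 0 := hb.ne'
      field_simp
    rw [h1]
    apply Real.sqrt_le_left (by positivity) |>.2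
    rw [← Real.exp_nat_mul]
    rw [inv_le_comm₀ (by linarith) (by positivity), ← Real.exp_neg]
    have h5 : 1 - 2 * c > 0 := by linarith
    rw [Real.exp_neg, inv_le_comm₀ (by positivity) h5]
    have h6 := Real.add_one_le_exp (((2 : ℕ) : ℝ) * (c + 4 * c ^ 2))
    refine le_trans ?_ h6
    rw [inv_le_iff_one_le_mul₀ h5]
    push_cast
    nlinarith [mul_nonneg (sq_nonneg c) (by linarith : 0 ≤ 1 / 4 - c)]

lemma gmgf {n : ℕ} (c : Fin n → ℝ) (hc : ∀ i, |c i| ≤ 1 / 4) :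
    ∫⁻ g, ENNReal.ofReal (Real.exp (∑ i, c i * g i ^ 2)) ∂(P n) ≤
      ENNReal.ofReal (Real.exp (∑ i, (c i + 4 * c i ^ 2))) := by
  simp only [Real.exp_sum]
  rw [← ofReal_integral_eq_lintegral_ofReal]
  · apply ENNReal.ofReal_le_ofReal
    rw [integral_fintype_prod_eq_prod (f := fun i x => Real.exp (c i * x ^ 2))]
    exact Finset.prod_le_prod (fun i _ => integral_nonneg fun x => (Real.exp_pos _).le)
      fun i _ => (oned _ (hc i)).2
  · exact Integrable.fintype_prod (f := fun i x => Real.exp (c i * x ^ 2)) fun i => (oned _ (hc i)).1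
  · exact Filter.Eventually.of_forall fun x => Finset.prod_nonneg fun i _ => (Real.exp_pos _).le

lemma jens {n : ℕ} (q : ℝ) : ENNReal.ofReal (Real.exp (n * q)) ≤
    ∫⁻ g, ENNReal.ofReal (Real.exp ((∑ i, g i ^ 2) * q)) ∂(P n) := by
  have hi1 : Integrable (fun x : ℝ => x ^ 2) (gaussianReal 0 1) :=
    (memLp_id_gaussianReal 2).integrable_sq
  have h1 : ∫ x : ℝ, x ^ 2 ∂(gaussianReal 0 1) = 1 := by
    have := variance_fun_id_gaussianReal (μ := 0) (v := 1)
    rw [variance_eq_integral (by fun_prop)] at this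
    simpa using this
  have hi : ∀ i : Fin n, Integrable (fun g : Fin n → ℝ => g i ^ 2) (P n) := fun i =>
    integrable_comp_eval (X := fun _ : Fin n => ℝ) (μ := fun _ => gaussianReal 0 1) (i := i)
      (f := fun x : ℝ => x ^ 2) hi1
  have h2 : ∫ g, (∑ i, g i ^ 2) ∂(P n) = n := by
    rw [integral_finsetSum _ fun i _ => hi i]
    have : ∀ i : Fin n, ∫ g, g i ^ 2 ∂(P n) = 1 := fun i => by
      rw [← h1]
      exact integral_comp_eval (X := fun _ : Fin n => ℝ) (μ := fun _ => gaussianReal 0 1) (i := i) (f := fun x : ℝ => x ^ 2) hi1.aestronglyMeasurable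
    simp [this]
  have his : Integrable (fun g : Fin n → ℝ => ∑ i, g i ^ 2) (P n) :=
    integrable_finsetSum _ fun i _ => hi i
  let F : (Fin n → ℝ) → ℝ := fun g => Real.exp (n * q) * (1 + ((∑ i, g i ^ 2) * q - n * q))
  have hF : Integrable F (P n) :=
    ((integrable_const _).add ((his.mul_const q).sub (integrable_const _))).const_mul _
  have his2 : Integrable (fun g : Fin n → ℝ => (∑ i, g i ^ 2) * q - n * q) (P n) :=
    (his.mul_const q).sub (integrable_const _)
  have hFi : ∫ g, F g ∂(P n) = Real.exp (n * q) := by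
    simp only [F]
    rw [integral_const_mul, integral_add (integrable_const _) his2,
      integral_sub (his.mul_const q) (integrable_const _), integral_mul_const, h2]
    simp
  rw [← hFi]
  calc ENNReal.ofReal (∫ g, F g ∂(P n)) ≤ ENNReal.ofReal (∫ g, max (F g) 0 ∂(P n)) := by
        apply ENNReal.ofReal_le_ofReal
        exact integral_mono hF hF.pos_part fun g => le_max_left _ _
    _ = ∫⁻ g, ENNReal.ofReal (max (F g) 0) ∂(P n) :=
        ofReal_integral_eq_lintegral_ofReal hF.pos_part (Filter.Eventually.of_forall fun g => le_max_right _ _)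
    _ ≤ _ := by
        refine lintegral_mono fun g => ENNReal.ofReal_le_ofReal ?_
        refine max_le ?_ (Real.exp_pos _).le
        have := Real.add_one_le_exp ((∑ i, g i ^ 2) * q - n * q)
        have h3 : Real.exp ((∑ i, g i ^ 2) * q)
          = Real.exp (n * q) * Real.exp ((∑ i, g i ^ 2) * q - n * q) := by
          rw [← Real.exp_add]; ring_nf
        rw [h3]
        exact mul_le_mul_of_nonneg_left (by linarith) (Real.exp_pos _).le

lemma Q_smul {n : ℕ} (B : Matrix (Fin n) (Fin n) ℝ) (r : ℝ) (v : Fin n → ℝ) :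
    Q B (r • v) = r ^ 2 * Q B v := by
  simp [Q, mulVec_smul]; ring

lemma mgf_haar {n : ℕ} (B : Matrix (Fin n) (Fin n) ℝ) (htr : B.trace = 0) (C : ℝ) (hC : 0 < C)
    (hHS : ∑ i, ∑ j, B i j ^ 2 ≤ C) (k : Fin n) [MeasurableSpace (On n)] [BorelSpace (On n)]
    (μ : Measure (On n)) [μ.IsMulLeftInvariant] [IsProbabilityMeasure μ] :
    ∫⁻ o, ENNReal.ofReal (Real.exp (n * ((32 * √C)⁻¹ *
      Q B ((o : Matrix (Fin n) (Fin n) ℝ) *ᵥ Pi.single k 1)))) ∂μ ≤ ENNReal.ofReal 3 := by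
  set θ := (32 * √C)⁻¹ with hθ
  have hθ0 : 0 < θ := by positivity
  have hθC : θ ^ 2 * C = 1 / 1024 := by
    rw [hθ, inv_pow, mul_pow, Real.sq_sqrt hC.le]
    field_simp
    norm_num
  obtain ⟨U, d, hd, hd0, hdC⟩ := diagz B htr C hHS
  let f : (Fin n → ℝ) → ENNReal := fun v => ENNReal.ofReal (Real.exp (θ * Q B v))
  have hQm : Continuous (Q B) := by unfold Q; fun_prop
  have hf : Measurable f := by
    apply Continuous.measurable
    apply ENNReal.continuous_ofReal.comp
    fun_prop
  have hval : Continuous (fun o : On n => (o : Matrix (Fin n) (Fin n) ℝ)) := continuous_subtype_val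
  have hjoint : Measurable (fun p : On n × (Fin n → ℝ) => f ((p.1 : Matrix (Fin n) (Fin n) ℝ) *ᵥ p.2)) := by
    apply Continuous.measurable
    have : Continuous (fun p : On n × (Fin n → ℝ) => (p.1 : Matrix (Fin n) (Fin n) ℝ) *ᵥ p.2) :=
      (hval.comp continuous_fst).matrix_mulVec continuous_snd
    apply ENNReal.continuous_ofReal.comp
    fun_prop
  have hinv : ∀ o : On n, ∫⁻ g, f ((o : Matrix (Fin n) (Fin n) ℝ) *ᵥ g) ∂(P n) = ∫⁻ g, f g ∂(P n) :=
    fun o => (rot o).lintegral_comp hf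
  have hbound : ∫⁻ g, f g ∂(P n) ≤ ENNReal.ofReal 3 := by
    rw [← hinv U]
    simp only [f, hd, Finset.mul_sum, ← mul_assoc]
    refine (gmgf (fun i => θ * d i) ?_).trans ?_
    · intro i
      apply abs_le_of_sq_le_sq _ (by norm_num)
      have : d i ^ 2 ≤ C := (Finset.single_le_sum (f := fun i => d i ^ 2)
        (fun i _ => sq_nonneg _) (Finset.mem_univ i)).trans hdC
      have := mul_le_mul_of_nonneg_left this (sq_nonneg θ)
      rw [mul_pow]; linarith
    · apply ENNReal.ofReal_le_ofReal
      have h1 : ∑ i, (θ * d i + 4 * (θ * d i) ^ 2) ≤ 1 := by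
        have : ∑ i, (θ * d i + 4 * (θ * d i) ^ 2) = θ * ∑ i, d i + 4 * (θ ^ 2 * ∑ i, d i ^ 2) := by
          simp only [Finset.sum_add_distrib, Finset.mul_sum, mul_pow]
        rw [this, hd0]
        have := mul_le_mul_of_nonneg_left hdC (sq_nonneg θ)
        linarith
      exact (Real.exp_le_exp.2 h1).trans Real.exp_one_lt_three.le
  refine le_trans ?_ hbound
  calc _ ≤ ∫⁻ o : On n, ∫⁻ g, ENNReal.ofReal (Real.exp ((∑ i, g i ^ 2) *
          (θ * Q B ((o : Matrix (Fin n) (Fin n) ℝ) *ᵥ Pi.single k 1)))) ∂(P n) ∂μ :=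
        lintegral_mono fun o => jens _
    _ = ∫⁻ g, ∫⁻ o : On n, ENNReal.ofReal (Real.exp ((∑ i, g i ^ 2) *
          (θ * Q B ((o : Matrix (Fin n) (Fin n) ℝ) *ᵥ Pi.single k 1)))) ∂μ ∂(P n) := by
        apply lintegral_lintegral_swap
        apply Measurable.aemeasurable
        apply Continuous.measurable
        have : Continuous (fun p : On n × (Fin n → ℝ) => (p.1 : Matrix (Fin n) (Fin n) ℝ) *ᵥ (Pi.single k 1 : Fin n → ℝ)) :=
          (hval.comp continuous_fst).matrix_mulVec continuous_const
        simp only [Function.uncurry_def]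
        apply ENNReal.continuous_ofReal.comp
        fun_prop
    _ = ∫⁻ g, ∫⁻ o : On n, f ((o : Matrix (Fin n) (Fin n) ℝ) *ᵥ g) ∂μ ∂(P n) := by
        congr 1
        ext g
        obtain ⟨h, r, hr, hg⟩ := house k g
        have hm : Measurable (fun o : On n => f ((o : Matrix (Fin n) (Fin n) ℝ) *ᵥ (r • Pi.single k 1))) :=
          hf.comp (hval.matrix_mulVec continuous_const).measurable
        have h5 := lint_right μ (fun o : On n =>
          f ((o : Matrix (Fin n) (Fin n) ℝ) *ᵥ (r • Pi.single k 1))) hm h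
        have h6 : ∀ o : On n, f ((o : Matrix (Fin n) (Fin n) ℝ) *ᵥ g) =
            f (((o * h : On n) : Matrix (Fin n) (Fin n) ℝ) *ᵥ (r • Pi.single k 1)) := by
          intro o
          conv_lhs => rw [hg]
          rw [mulVec_smul, mulVec_smul, mulVec_mulVec]
          rfl
        rw [lintegral_congr h6, h5]
        refine lintegral_congr fun o => ?_
        simp only [f]
        rw [mulVec_smul, Q_smul, ← hr]
        congr 2; ring
    _ = ∫⁻ o : On n, ∫⁻ g, f ((o : Matrix (Fin n) (Fin n) ℝ) *ᵥ g) ∂(P n) ∂μ :=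
        (lintegral_lintegral_swap hjoint.aemeasurable).symm
    _ = _ := by simp [hinv]

lemma tail {n : ℕ} (B : Matrix (Fin n) (Fin n) ℝ) (htr : B.trace = 0) (C : ℝ) (hC : 0 < C)
    (hHS : ∑ i, ∑ j, B i j ^ 2 ≤ C) (k : Fin n) (T : ℝ)
    [MeasurableSpace (On n)] [BorelSpace (On n)]
    (μ : Measure (On n)) [μ.IsMulLeftInvariant] [IsProbabilityMeasure μ] :
    μ {o : On n | T ≤ Q B ((o : Matrix (Fin n) (Fin n) ℝ) *ᵥ Pi.single k 1)} ≤
      ENNReal.ofReal (3 * Real.exp (-(n * T / (32 * √C)))) := by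
  have hθ0 : 0 < (32 * √C)⁻¹ := by positivity
  have h := mgf_haar B htr C hC hHS k μ
  set ε := ENNReal.ofReal (Real.exp (n * ((32 * √C)⁻¹ * T))) with hε
  have hm := meas_ge_le_lintegral_div (μ := μ) (ε := ε) (f := fun o : On n =>
    ENNReal.ofReal (Real.exp (n * ((32 * √C)⁻¹ * Q B ((o : Matrix (Fin n) (Fin n) ℝ) *ᵥ Pi.single k 1)))))
    (by
      apply Measurable.aemeasurable
      apply Continuous.measurable
      have hval : Continuous (fun o : On n => (o : Matrix (Fin n) (Fin n) ℝ)) := continuous_subtype_val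
      have hQm : Continuous (Q B) := by unfold Q; fun_prop
      have := hval.matrix_mulVec (continuous_const (y := (Pi.single k 1 : Fin n → ℝ)))
      apply ENNReal.continuous_ofReal.comp
      fun_prop)
    (by simp [hε, Real.exp_pos]) ENNReal.ofReal_ne_top
  refine (measure_mono ?_).trans (hm.trans ((ENNReal.div_le_div_right h _).trans ?_))
  · intro o ho
    simp only [Set.mem_ofPred_eq] at ho ⊢
    apply ENNReal.ofReal_le_ofReal
    gcongr
  · rw [hε, ← ENNReal.ofReal_div_of_pos (Real.exp_pos _), div_eq_mul_inv, ← Real.exp_neg]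
    apply le_of_eq
    congr 3
    rw [div_eq_mul_inv]; ring

end HWaux

/-- Concentration for diagonal matrix coefficients `⟨o eₖ, B o eₖ⟩` of a trace-zero real matrix
`B` under a Haar-random orthogonal matrix `o ∈ O(n)`. -/
theorem stmt_12 (n : ℕ) (hn : 1 ≤ n)
    (C : ℝ) (hC : 0 < C)
    (B : Matrix (Fin n) (Fin n) ℝ)
    (htr : B.trace = 0)
    (hHS : ∑ i, ∑ j, B i j ^ 2 ≤ C)
    (k : Fin n) (T : ℝ) (hT : 0 < T)
    [MeasurableSpace (Matrix.orthogonalGroup (Fin n) ℝ)]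
    [BorelSpace (Matrix.orthogonalGroup (Fin n) ℝ)]
    (μ : Measure (Matrix.orthogonalGroup (Fin n) ℝ))
    [μ.IsMulLeftInvariant] [IsProbabilityMeasure μ] :
    μ {o : Matrix.orthogonalGroup (Fin n) ℝ |
        T ≤ |∑ i, ∑ j, o i k * B i j * o j k|} ≤
      ENNReal.ofReal (6 * Real.exp (-(n * T / (32 * Real.sqrt C))) +
        2 * Real.exp (-(n : ℝ) / 12)) := by
  have h1 := HWaux.tail B htr C hC hHS k T μ
  have h2 := HWaux.tail (-B) (by simp [htr]) C hC (by simpa using hHS) k T μ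
  have hQ : ∀ (A : Matrix (Fin n) (Fin n) ℝ) (o : Matrix.orthogonalGroup (Fin n) ℝ),
      HWaux.Q A (Matrix.mulVec (o : Matrix (Fin n) (Fin n) ℝ) (Pi.single k 1))
        = ∑ i, ∑ j, o i k * A i j * o j k := by
    intro A o
    rw [HWaux.Q, Matrix.mulVec_single_one]
    simp [dotProduct, Matrix.mulVec, Finset.mul_sum, mul_assoc]
  refine (measure_mono (t := _ ∪ _) ?_).trans ((measure_union_le _ _).trans
    ((add_le_add h1 h2).trans ?_))
  · intro o ho
    simp only [Set.mem_ofPred_eq, Set.mem_union, hQ] at ho ⊢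
    simpa [le_abs] using ho
  · rw [← ENNReal.ofReal_add (by positivity) (by positivity)]
    apply ENNReal.ofReal_le_ofReal
    have := Real.exp_pos (-(n : ℝ) / 12)
    linarith
end
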